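/- arXiv:1512.08695 — 12 statements merged into one kernel-verified Lean document; each statement's English description precedes it below -/
import Mathlib

section
/- Let (G,+) be a semimodule over a discrete semiring (R,+,·) and let G = B₁ ∪ ⋯ ∪ B_q be a partition of G into finitely many subsets. Then there exists an index j ∈ {1,…,q} with the following property: for every finite set F ⊆ G there is a syndetic subset D_F of (R,+) such that for each d ∈ D_F there exists a ∈ B_j with a + d•F ⊆ B_j, where a + d•F = {a + d•g : g ∈ F}. -/
/-- A subset `N` of `(R,+)` is syndetic if there is a finite set `K ⊆ R` such that
`(K + t) ∩ N ≠ ∅` for every `t ∈ R`. -/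
def Syndetic {R : Type*} [Add R] (N : Set R) : Prop :=
  ∃ K : Finset R, ∀ t : R, ∃ k ∈ K, k + t ∈ N

/-- A subset of an additive monoid is thick if it contains a translate of every finite set. -/
def AddThick {M : Type*} [Add M] (T : Set M) : Prop :=
  ∀ E : Finset M, ∃ x : M, ∀ e ∈ E, x + e ∈ T

/-- A subset of an additive monoid is piecewise syndetic if finitely many of its translates
cover a thick set. -/
def AddPiecewiseSyndetic {M : Type*} [Add M] (A : Set M) : Prop :=
  ∃ H : Finset M, AddThick {x : M | ∃ h ∈ H, x + h ∈ A}

/-- Removing a set that is not piecewise syndetic from a thick set leaves a thick set. -/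
theorem AddThick.of_union {M : Type*} [AddSemigroup M] {A B : Set M} (h : AddThick (A ∪ B))
    (hA : ¬ AddPiecewiseSyndetic A) : AddThick B := by
  classical
  intro H
  have hH : ¬ AddThick {x : M | ∃ h ∈ H, x + h ∈ A} := fun hT => hA ⟨H, hT⟩
  simp only [AddThick, Set.mem_ofPred_eq] at hH
  push Not at hH
  obtain ⟨E, hE⟩ := hH
  obtain ⟨x, hx⟩ := h (Finset.image₂ (· + ·) E H)
  obtain ⟨e, he, hxe⟩ := hE x
  refine ⟨x + e, fun k hk => ?_⟩
  have hmem := hx (e + k) (Finset.mem_image₂_of_mem he hk)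
  rw [← add_assoc] at hmem
  exact hmem.resolve_left (hxe k hk)

/-- Piecewise syndeticity is partition regular. -/
theorem AddThick.exists_addPiecewiseSyndetic {M ι : Type*} [AddMonoid M] (B : ι → Set M)
    (s : Finset ι) (h : AddThick (⋃ i ∈ s, B i)) : ∃ i ∈ s, AddPiecewiseSyndetic (B i) := by
  classical
  induction s using Finset.induction_on with
  | empty => obtain ⟨x, hx⟩ := h {0}; simp at hx
  | insert a s _ ih =>
    by_cases ha : AddPiecewiseSyndetic (B a)
    · exact ⟨a, Finset.mem_insert_self a s, ha⟩
    · rw [Finset.set_biUnion_insert] at h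
      obtain ⟨i, hi, hB⟩ := ih (h.of_union ha)
      exact ⟨i, Finset.mem_insert_of_mem hi, hB⟩

/-- The complement of a non-syndetic set contains all finite sums of some family indexed by a
given finite set. -/
theorem exists_sum_notMem_of_not_syndetic {R ι : Type*} [AddCommMonoid R] {D : Set R}
    (hD : ¬ Syndetic D) (u : Finset ι) :
    ∃ x : ι → R, ∀ s ⊆ u, s.Nonempty → ∑ i ∈ s, x i ∉ D := by
  classical
  simp only [Syndetic] at hD
  push Not at hD
  induction u using Finset.induction_on with
  | empty => exact ⟨0, fun s hs hne => absurd (Finset.subset_empty.mp hs) hne.ne_empty⟩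
  | insert a u ha ih =>
    obtain ⟨x, hx⟩ := ih
    obtain ⟨t, ht⟩ := hD (u.powerset.image fun s => ∑ i ∈ s, x i)
    have hupd : ∀ s : Finset ι, a ∉ s → ∑ i ∈ s, Function.update x a t i = ∑ i ∈ s, x i :=
      fun s has => Finset.sum_congr rfl fun i hi =>
        Function.update_of_ne (ne_of_mem_of_not_mem hi has) _ _
    refine ⟨Function.update x a t, fun s hs hne => ?_⟩
    by_cases has : a ∈ s
    · rw [← Finset.sum_erase_add s _ has, hupd _ (Finset.notMem_erase a s),
        Function.update_self]
      exact ht _ (Finset.mem_image_of_mem _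
        (Finset.mem_powerset.mpr (Finset.subset_insert_iff.mp hs)))
    · rw [hupd s has]
      exact hx s ((Finset.subset_insert_iff_of_notMem has).mp hs) hne

/-- Along a piecewise syndetic set, the dilation factors of homothetic copies of a finite set
form a syndetic set. -/
theorem AddPiecewiseSyndetic.syndetic_dilations {R G : Type*} [Semiring R] [AddCommMonoid G]
    [Module R G] {A : Set G} (hA : AddPiecewiseSyndetic A) (F : Finset G) :
    Syndetic {d : R | ∃ a ∈ A, ∀ g ∈ F, a + d • g ∈ A} := by
  classical
  by_contra hD
  obtain ⟨H, hH⟩ := hA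
  obtain ⟨ι, _, hι⟩ := Combinatorics.Line.exists_mono_in_high_dimension
    (↥(insert 0 F : Finset G)) H
  obtain ⟨x, hx⟩ := exists_sum_notMem_of_not_syndetic hD (Finset.univ : Finset ι)
  obtain ⟨y, hy⟩ := hH (Finset.univ.image
    fun w : ι → ↥(insert 0 F : Finset G) => ∑ i, x i • (w i : G))
  have hcol : ∀ w : ι → ↥(insert 0 F : Finset G),
      ∃ h : H, y + ∑ i, x i • (w i : G) + h ∈ A := fun w => by
    obtain ⟨h, hh, hmem⟩ := hy _ (Finset.mem_image_of_mem _ (Finset.mem_univ w))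
    exact ⟨⟨h, hh⟩, hmem⟩
  choose C hC using hcol
  obtain ⟨l, c, hl⟩ := hι C
  let S : Finset ι := {i | l.idxFun i = none}
  obtain ⟨i₀, hi₀⟩ := l.proper
  refine hx S (Finset.subset_univ S) ⟨i₀, by simp [S, hi₀]⟩ ?_
  let z : ↥(insert 0 F : Finset G) := ⟨0, Finset.mem_insert_self 0 F⟩
  have hsum : ∀ g : ↥(insert 0 F : Finset G),
      ∑ i, x i • (l g i : G) = ∑ i, x i • (l z i : G) + (∑ i ∈ S, x i) • (g : G) := fun g => by
    rw [Finset.sum_smul, Finset.sum_filter, ← Finset.sum_add_distrib]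
    refine Finset.sum_congr rfl fun i _ => ?_
    cases hi : l.idxFun i with
    | none => simp [hi, z]
    | some a => simp [hi]
  have hmem : ∀ g : ↥(insert 0 F : Finset G),
      y + ∑ i, x i • (l z i : G) + c + (∑ i ∈ S, x i) • (g : G) ∈ A := fun g => by
    have := hC (l g)
    rwa [hl g, hsum g, ← add_assoc, add_right_comm] at this
  refine ⟨y + ∑ i, x i • (l z i : G) + c, by simpa [z] using hmem z, fun g hg => ?_⟩
  exact hmem ⟨g, Finset.mem_insert_of_mem hg⟩

/-- Grünwald version of van der Waerden's theorem for semimodules: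
for any finite coloring `G = B₁ ∪ ⋯ ∪ B_q` of a semimodule `G` over a discrete
semiring `R`, some color `B j` has the property that for every finite `F ⊆ G`
there is a syndetic set `D_F ⊆ R` such that for each `d ∈ D_F` there is `a ∈ B j`
with `a + d • F ⊆ B j`. -/
theorem vdW_semimodule {R G : Type*} [Semiring R] [AddCommMonoid G] [Module R G]
    {q : ℕ} (B : Fin q → Set G) (hcover : (⋃ j, B j) = Set.univ) :
    ∃ j : Fin q, ∀ F : Finset G, ∃ D : Set R, Syndetic D ∧
      ∀ d ∈ D, ∃ a ∈ B j, ∀ g ∈ F, a + d • g ∈ B j := by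
  have hthick : AddThick (⋃ j ∈ (Finset.univ : Finset (Fin q)), B j) := by
    simp [hcover, AddThick]
  obtain ⟨j, -, hj⟩ := hthick.exists_addPiecewiseSyndetic
  exact ⟨j, fun F => ⟨_, hj.syndetic_dilations F, fun _ hd => hd⟩⟩
end

section
/- Let m ≥ 1 and let ℝ^m = B₁ ∪ ⋯ ∪ B_q be a partition of ℝ^m into finitely many subsets. Then there exists an index j ∈ {1,…,q} with the following property: for every finite set F ⊆ ℝ^m there exist a ∈ B_j and d ∈ ℝ with d ≠ 0 such that a + d•F ⊆ B_j, where a + d•F = {a + d•v : v ∈ F} and d•v denotes scalar multiplication in the real vector space ℝ^m. -/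
/-- Van der Waerden theorem for the module `ℝ^m` over the real field:
for any finite coloring of `ℝ^m`, some color `B j` has the property that for every
finite `F ⊆ ℝ^m` there are `a ∈ B j` and `d ∈ ℝ`, `d ≠ 0`, with `a + d • F ⊆ B j`. -/
theorem vdW_real_vector_space {m : ℕ} (hm : 1 ≤ m) {q : ℕ}
    (B : Fin q → Set (Fin m → ℝ)) (hcover : (⋃ j, B j) = Set.univ) :
    ∃ j : Fin q, ∀ F : Finset (Fin m → ℝ), ∃ a ∈ B j, ∃ d : ℝ, d ≠ 0 ∧
      ∀ v ∈ F, a + d • v ∈ B j := by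
  classical
  by_contra! h
  choose F hF using h
  choose C hC using Set.iUnion_eq_univ_iff.mp hcover
  obtain ⟨n, hn, b, c, hc⟩ :=
    Combinatorics.exists_mono_homothetic_copy (insert 0 (Finset.univ.biUnion F)) C
  have mem_color : ∀ s ∈ insert 0 (Finset.univ.biUnion F), n • s + b ∈ B c :=
    fun s hs => hc s hs ▸ hC (n • s + b)
  have hb : b ∈ B c := by simpa using mem_color 0 (Finset.mem_insert_self _ _)
  obtain ⟨v, hv, hvB⟩ := hF c b hb n (Nat.cast_ne_zero.mpr hn.ne')
  refine hvB ?_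
  rw [Nat.cast_smul_eq_nsmul, add_comm]
  exact mem_color v
    (Finset.mem_insert_of_mem (Finset.mem_biUnion.mpr ⟨c, Finset.mem_univ c, hv⟩))
end

section
/- Let (G,+) be a semimodule over a discrete semiring (R,+,·), let X be a nonempty set, and let φ : G × X → X satisfy φ(e,x) = x and φ(f + g, x) = φ(f, φ(g, x)) for all f,g ∈ G and x ∈ X, where e is the zero element of G. Then for every partition X = X₁ ∪ ⋯ ∪ X_q into finitely many subsets, there exists an index α ∈ {1,…,q} such that for all T₁,…,T_l ∈ G one can find a syndetic subset D of (R,+) with the property that for every d ∈ D there exists x ∈ X_α with φ(d•Tᵢ, x) ∈ X_α for every i = 1,…,l. -/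
/-- A subset `A` of an additive monoid is piecewise syndetic if finitely many of its translates
together contain a translate of every finite set. -/
def PiecewiseSyndetic {G : Type*} [Add G] (A : Set G) : Prop :=
  ∃ H : Finset G, ∀ E : Finset G, ∃ g : G, ∀ e ∈ E, ∃ h ∈ H, h + e + g ∈ A

theorem PiecewiseSyndetic.univ {G : Type*} [AddMonoid G] :
    PiecewiseSyndetic (Set.univ : Set G) :=
  ⟨{0}, fun _ => ⟨0, fun _ _ => ⟨0, by simp, trivial⟩⟩⟩

theorem not_piecewiseSyndetic_empty {G : Type*} [AddMonoid G] :
    ¬ PiecewiseSyndetic (∅ : Set G) := by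
  rintro ⟨H, hH⟩
  obtain ⟨g, hg⟩ := hH {0}
  obtain ⟨h, -, hh⟩ := hg 0 (by simp)
  exact hh

theorem PiecewiseSyndetic.of_union {G : Type*} [AddCommMonoid G] {A B : Set G}
    (hAB : PiecewiseSyndetic (A ∪ B)) : PiecewiseSyndetic A ∨ PiecewiseSyndetic B := by
  classical
  obtain ⟨H, hH⟩ := hAB
  by_contra! hcon
  obtain ⟨hA, hB⟩ := hcon
  simp only [PiecewiseSyndetic, not_exists, not_forall] at hA
  obtain ⟨E', hE'⟩ := hA H
  refine hB ⟨(H ×ˢ E').image fun p => p.1 + p.2, fun E => ?_⟩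
  obtain ⟨g, hg⟩ := hH ((E ×ˢ E').image fun p => p.1 + p.2)
  refine ⟨g, fun e he => ?_⟩
  obtain ⟨e', he', hnot⟩ := hE' (e + g)
  obtain ⟨h, hh, hmem⟩ := hg (e + e') (Finset.mem_image.2 ⟨(e, e'), by simp [he, he'], rfl⟩)
  refine ⟨h + e', Finset.mem_image.2 ⟨(h, e'), by simp [hh, he'], rfl⟩, ?_⟩
  rcases hmem with hmem | hmem
  · refine absurd ⟨hh, ?_⟩ (hnot h)
    convert hmem using 1
    abel
  · convert hmem using 1
    abel

theorem PiecewiseSyndetic.exists_of_biUnion {G κ : Type*} [AddCommMonoid G] (A : κ → Set G)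
    (s : Finset κ) (h : PiecewiseSyndetic (⋃ j ∈ s, A j)) :
    ∃ j ∈ s, PiecewiseSyndetic (A j) := by
  classical
  induction s using Finset.induction_on with
  | empty => exact absurd (by simpa using h) (not_piecewiseSyndetic_empty (G := G))
  | insert a s _ ih =>
    rw [Finset.set_biUnion_insert] at h
    rcases h.of_union with h | h
    · exact ⟨a, by simp, h⟩
    · obtain ⟨j, hj, hA⟩ := ih h
      exact ⟨j, by simp [hj], hA⟩

/-- The complement of a non-syndetic set contains all nonempty sums of arbitrarily long finite
families. -/
theorem exists_forall_sum_notMem_of_not_syndetic {R ι : Type*} [AddCommMonoid R] {D : Set R}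
    (hD : ¬ Syndetic D) (s : Finset ι) :
    ∃ r : ι → R, ∀ u ⊆ s, u.Nonempty → ∑ i ∈ u, r i ∉ D := by
  classical
  induction s using Finset.induction_on with
  | empty => exact ⟨0, fun u hu hne => absurd (Finset.subset_empty.1 hu) hne.ne_empty⟩
  | insert a s ha ih =>
    obtain ⟨r, hr⟩ := ih
    simp only [Syndetic, not_exists, not_forall] at hD
    obtain ⟨t, ht⟩ := hD (s.powerset.image fun u => ∑ i ∈ u, r i)
    refine ⟨Function.update r a t, fun u hu hne => ?_⟩
    by_cases hau : a ∈ u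
    · have hsub : u.erase a ⊆ s := by
        intro x hx
        have := hu (Finset.mem_of_mem_erase hx)
        simpa [Finset.ne_of_mem_erase hx] using this
      rw [← Finset.sum_erase_add _ _ hau, Function.update_self,
        Finset.sum_update_of_notMem (Finset.notMem_erase a u)]
      exact fun hmem =>
        ht _ ⟨Finset.mem_image_of_mem _ (Finset.mem_powerset.2 hsub), hmem⟩
    · rw [Finset.sum_update_of_notMem hau]
      exact hr u ((Finset.subset_insert_iff_of_notMem hau).1 hu) hne

/-- The set of dilation factors of configurations found in a piecewise syndetic set is syndetic. -/
theorem PiecewiseSyndetic.syndetic_setOf_exists_add_smul_mem {R G : Type*} [Semiring R]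
    [AddCommMonoid G] [Module R G] {A : Set G} (hA : PiecewiseSyndetic A) {l : ℕ}
    (T : Fin l → G) : Syndetic {d : R | ∃ a ∈ A, ∀ i, d • T i + a ∈ A} := by
  classical
  by_contra hD
  obtain ⟨H, hH⟩ := hA
  obtain ⟨ι, _, hι⟩ := Combinatorics.Line.exists_mono_in_high_dimension (Option (Fin l)) H
  obtain ⟨r, hr⟩ := exists_forall_sum_notMem_of_not_syndetic hD (Finset.univ : Finset ι)
  let S : Option (Fin l) → G := fun o => o.elim 0 T
  let f : (ι → Option (Fin l)) → G := fun w => ∑ i, r i • S (w i)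
  obtain ⟨g, hg⟩ := hH (Finset.univ.image f)
  have hcol : ∀ w, ∃ h : H, (h : G) + f w + g ∈ A := fun w => by
    obtain ⟨h, hh, hmem⟩ := hg (f w) (Finset.mem_image_of_mem _ (Finset.mem_univ w))
    exact ⟨⟨h, hh⟩, hmem⟩
  choose C hC using hcol
  obtain ⟨L, c, hc⟩ := hι C
  have hline : ∀ x, f (L x) =
      (∑ i ∈ Finset.univ.filter (fun i => L.idxFun i = none), r i) • S x + f (L none) := by
    intro x
    simp only [f]
    rw [Finset.sum_filter, Finset.sum_smul, ← Finset.sum_add_distrib]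
    refine Finset.sum_congr rfl fun i _ => ?_
    rcases hi : L.idxFun i with _ | y <;> simp [hi, S]
  obtain ⟨i₀, hi₀⟩ := L.proper
  refine hr (Finset.univ.filter fun i => L.idxFun i = none) (Finset.subset_univ _)
    ⟨i₀, by simp [hi₀]⟩ ⟨c + f (L none) + g, ?_, fun i => ?_⟩
  · simpa [hc] using hC (L none)
  · have h := hC (L (some i))
    rw [hc, hline] at h
    convert h using 1
    simp only [S, Option.elim_some]
    abel

/-- For a discrete dynamical system `φ : G × X → X` of a semimodule `G` over a discrete
semiring `R` on a nonempty set `X` and a finite partition `X = X₁ ∪ ⋯ ∪ X_q`, some cell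
`Xp α` has the property that for any `T₁,…,T_l ∈ G` there is a syndetic set `D ⊆ R` such
that for each `d ∈ D` there is a point `x ∈ Xp α` with `φ (d • Tᵢ) x ∈ Xp α` for all `i`. -/
theorem vdW_discrete_dynamics {R G X : Type*} [Semiring R] [AddCommMonoid G] [Module R G]
    [Nonempty X] (φ : G → X → X)
    (hid : ∀ x : X, φ 0 x = x)
    (hadd : ∀ f g : G, ∀ x : X, φ (f + g) x = φ f (φ g x))
    {q : ℕ} (Xp : Fin q → Set X) (hcover : (⋃ j, Xp j) = Set.univ) :
    ∃ α : Fin q, ∀ (l : ℕ) (T : Fin l → G), ∃ D : Set R, Syndetic D ∧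
      ∀ d ∈ D, ∃ x ∈ Xp α, ∀ i : Fin l, φ (d • T i) x ∈ Xp α := by
  obtain ⟨x₀⟩ := ‹Nonempty X›
  obtain ⟨α, -, hα⟩ := PiecewiseSyndetic.exists_of_biUnion (fun j => {g : G | φ g x₀ ∈ Xp j})
    Finset.univ (by
      have huniv : ⋃ j ∈ Finset.univ, {g : G | φ g x₀ ∈ Xp j} = Set.univ := by
        refine Set.eq_univ_of_forall fun g => ?_
        have h : φ g x₀ ∈ ⋃ j, Xp j := hcover ▸ Set.mem_univ _
        simpa using h
      rw [huniv]
      exact PiecewiseSyndetic.univ)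
  refine ⟨α, fun l T => ⟨_, hα.syndetic_setOf_exists_add_smul_mem T, ?_⟩⟩
  rintro d ⟨a, ha, haT⟩
  exact ⟨φ a x₀, ha, fun i => hadd (d • T i) a x₀ ▸ haT i⟩
end

section
/- Let (G,+) be a semimodule over a discrete semiring (R,+,·) and let φ : G × X → X be a minimal topological dynamical system over a nonempty compact Hausdorff space X. Then for any T₁,…,T_l ∈ G and any nonempty open subset U of X, the set N_{T₁,…,T_l}(U) = {t ∈ R : there exists x ∈ U with φ(t•Tᵢ, x) ∈ U for every i = 1,…,l} is syndetic in (R,+). -/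
/-- A thick subset of an additive commutative monoid contains all nonempty subsums of some family
indexed by a given finite set. -/
theorem exists_sum_mem_of_thick {R : Type*} [AddCommMonoid R] {A : Set R}
    (hA : ∀ K : Finset R, ∃ t, ∀ k ∈ K, k + t ∈ A) {ι : Type*} (s : Finset ι) :
    ∃ t : ι → R, ∀ S ⊆ s, S.Nonempty → ∑ i ∈ S, t i ∈ A := by
  classical
  induction s using Finset.induction_on with
  | empty => exact ⟨0, fun S hS hne => absurd (Finset.subset_empty.1 hS) hne.ne_empty⟩
  | insert a s ha ih =>
    obtain ⟨t, ht⟩ := ih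
    obtain ⟨r, hr⟩ := hA (s.powerset.image fun S => ∑ i ∈ S, t i)
    have hsum : ∀ S : Finset ι, a ∉ S → ∑ i ∈ S, Function.update t a r i = ∑ i ∈ S, t i :=
      fun S hS => Finset.sum_congr rfl fun i hi =>
        Function.update_of_ne (ne_of_mem_of_not_mem hi hS) _ _
    refine ⟨Function.update t a r, fun S hS hne => ?_⟩
    by_cases haS : a ∈ S
    · rw [← Finset.sum_erase_add _ _ haS, hsum _ (Finset.notMem_erase a S),
        Function.update_self]
      exact hr _ (Finset.mem_image_of_mem _
        (Finset.mem_powerset.2 (Finset.subset_insert_iff.1 hS)))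
    · rw [hsum S haS]
      exact ht S ((Finset.subset_insert_iff_of_notMem haS).1 hS) hne

/-- In a minimal system, finitely many preimages of a nonempty open set cover the space. -/
theorem exists_finset_forall_exists_mem_of_minimal {G X : Type*} [AddCommMonoid G]
    [TopologicalSpace X] [CompactSpace X] (φ : G → X → X)
    (hadd : ∀ g h : G, ∀ x : X, φ (g + h) x = φ g (φ h x))
    (hcont : ∀ g : G, Continuous (φ g))
    (hmin : ∀ Y : Set X, IsClosed Y → Y.Nonempty →
      (∀ g : G, ∀ y ∈ Y, φ g y ∈ Y) → Y = Set.univ)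
    {U : Set X} (hUopen : IsOpen U) (hUne : U.Nonempty) :
    ∃ F : Finset G, ∀ x, ∃ g ∈ F, φ g x ∈ U := by
  have hcover : (Set.univ : Set X) ⊆ ⋃ g, φ g ⁻¹' U := by
    intro x _
    have horbit : closure (Set.range fun g => φ g x) = Set.univ := by
      refine hmin _ isClosed_closure ⟨φ 0 x, subset_closure ⟨0, rfl⟩⟩ fun g y hy => ?_
      refine map_mem_closure (hcont g) hy ?_
      rintro _ ⟨h, rfl⟩
      exact ⟨g + h, hadd g h x⟩
    obtain ⟨u, hu⟩ := hUne
    obtain ⟨_, hgU, g, rfl⟩ :=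
      mem_closure_iff.1 (horbit ▸ Set.mem_univ u) U hUopen hu
    exact Set.mem_iUnion.2 ⟨g, hgU⟩
  obtain ⟨F, hF⟩ := isCompact_univ.elim_finite_subcover _
    (fun g => hUopen.preimage (hcont g)) hcover
  exact ⟨F, fun x => by simpa using hF (Set.mem_univ x)⟩

/-- Along a combinatorial line, the weighted sum of the letters is affine in the moving letter. -/
theorem exists_sum_smul_line_eq {R G α ι : Type*} [Semiring R] [AddCommMonoid G] [Module R G]
    [Fintype ι] (L : Combinatorics.Line α ι) (t : ι → R) (T : α → G) :
    ∃ S : Finset ι, S.Nonempty ∧ ∃ g : G, ∀ a,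
      ∑ i, t i • T (L a i) = g + (∑ i ∈ S, t i) • T a := by
  classical
  obtain ⟨i₀, hi₀⟩ := L.proper
  refine ⟨Finset.univ.filter fun i => L.idxFun i = none, ⟨i₀, by simpa using hi₀⟩,
    ∑ i with L.idxFun i ≠ none, t i • ((L.idxFun i).map T).getD 0, fun a => ?_⟩
  rw [← Finset.sum_filter_not_add_sum_filter Finset.univ (fun i => L.idxFun i = none),
    Finset.sum_smul]
  congr 1
  · refine Finset.sum_congr rfl fun i hi => ?_
    obtain ⟨b, hb⟩ := Option.ne_none_iff_exists'.1 (Finset.mem_filter.1 hi).2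
    simp [hb]
  · refine Finset.sum_congr rfl fun i hi => ?_
    rw [L.apply_none a i (Finset.mem_filter.1 hi).2]


/-- Regional Multiple Recurrence Theorem: for a minimal topological dynamical system
`φ : G × X → X` of a semimodule `G` over a discrete semiring `R` on a nonempty compact
Hausdorff space `X`, given `T₁,…,T_l ∈ G` and a nonempty open `U ⊆ X`, the hitting-time
set `N_{T₁,…,T_l}(U) = {t ∈ R : U ∩ φ^{-t•T₁}[U] ∩ ⋯ ∩ φ^{-t•T_l}[U] ≠ ∅}` is syndetic
in `(R,+)`. -/
theorem regional_multiple_recurrence {R G X : Type*} [Semiring R] [AddCommMonoid G]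
    [Module R G] [TopologicalSpace X] [CompactSpace X] [T2Space X] [Nonempty X]
    (φ : G → X → X)
    (hid : ∀ x : X, φ 0 x = x)
    (hadd : ∀ g h : G, ∀ x : X, φ (g + h) x = φ g (φ h x))
    (hcont : ∀ g : G, Continuous (φ g))
    (hmin : ∀ Y : Set X, IsClosed Y → Y.Nonempty →
      (∀ g : G, ∀ y ∈ Y, φ g y ∈ Y) → Y = Set.univ)
    {l : ℕ} (T : Fin l → G) (U : Set X) (hUopen : IsOpen U) (hUne : U.Nonempty) :
    Syndetic {t : R | ∃ x ∈ U, ∀ i : Fin l, φ (t • T i) x ∈ U} := by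
  obtain ⟨F, hF⟩ := exists_finset_forall_exists_mem_of_minimal φ hadd hcont hmin hUopen hUne
  by_contra hN
  have hthick : ∀ K : Finset R, ∃ t, ∀ k ∈ K,
      k + t ∈ {t : R | ∃ x ∈ U, ∀ i : Fin l, φ (t • T i) x ∈ U}ᶜ := by
    simpa only [Syndetic, not_exists, not_forall, not_and, Set.mem_compl_iff] using hN
  obtain ⟨ι, _, hι⟩ := Combinatorics.Line.exists_mono_in_high_dimension (Option (Fin l)) F
  obtain ⟨t, ht⟩ := exists_sum_mem_of_thick hthick (Finset.univ : Finset ι)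
  let T' : Option (Fin l) → G := fun a => a.elim 0 T
  obtain ⟨x⟩ := ‹Nonempty X›
  choose f hfF hfU using hF
  obtain ⟨L, c, hc⟩ := hι fun w => ⟨f (φ (∑ i, t i • T' (w i)) x), hfF _⟩
  obtain ⟨S, hS, g, hg⟩ := exists_sum_smul_line_eq L t T'
  have key : ∀ a, φ ((∑ i ∈ S, t i) • T' a) (φ (c + g) x) ∈ U := by
    intro a
    have h := hfU (φ (∑ i, t i • T' (L a i)) x)
    have hca : f (φ (∑ i, t i • T' (L a i)) x) = c := congrArg Subtype.val (hc a)
    rw [hca, hg, ← hadd] at h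
    rwa [← hadd, add_comm, add_assoc]
  refine ht S (Finset.subset_univ S) hS ⟨φ (c + g) x, ?_, fun i => key (some i)⟩
  simpa [T', hid] using key none
end

section
/- Let (G,+) be a semimodule over a discrete semiring (R,+,·), let φ : G × X → X be a topological dynamical system over a nonempty compact Hausdorff space X, and let 𝔘 be an open cover of X. Then there exists U ∈ 𝔘 such that for any T₁,…,T_l ∈ G the set N_{T₁,…,T_l}(U) = {t ∈ R : there exists x ∈ U with φ(t•Tᵢ, x) ∈ U for every i = 1,…,l} is syndetic in (R,+). -/
/-- If `N` is not syndetic, there are finite families of any size all of whose nonempty finite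
sums avoid `N`. -/
theorem exists_finset_sums_notMem_of_not_syndetic {R ι : Type*} [AddCommMonoid R] {N : Set R}
    (hN : ¬ Syndetic N) (s : Finset ι) :
    ∃ r : ι → R, ∀ S ⊆ s, S.Nonempty → ∑ i ∈ S, r i ∉ N := by
  classical
  induction s using Finset.induction_on with
  | empty => exact ⟨0, fun S hS hne => absurd (Finset.subset_empty.mp hS) hne.ne_empty⟩
  | insert a s ha ih =>
    obtain ⟨r, hr⟩ := ih
    simp only [Syndetic, not_exists, not_forall, not_and] at hN
    obtain ⟨t, ht⟩ := hN (s.powerset.image fun S => ∑ i ∈ S, r i)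
    have sum_update (S : Finset ι) (hS : a ∉ S) :
        ∑ i ∈ S, Function.update r a t i = ∑ i ∈ S, r i :=
      Finset.sum_congr rfl fun i hi =>
        Function.update_of_ne (ne_of_mem_of_not_mem hi hS) _ _
    refine ⟨Function.update r a t, fun S hS hne => ?_⟩
    by_cases haS : a ∈ S
    · rw [← Finset.sum_erase_add _ _ haS, sum_update _ (Finset.notMem_erase a S),
        Function.update_self]
      exact ht _ (Finset.mem_image_of_mem _
        (Finset.mem_powerset.mpr (Finset.subset_insert_iff.mp hS)))
    · rw [sum_update S haS]
      exact hr S ((Finset.subset_insert_iff_of_notMem haS).mp hS) hne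

/-- Weighted sums along a combinatorial line differ by multiples of the sum of the weights over
the active coordinates. -/
theorem Combinatorics.Line.sum_smul_apply {R G α ι : Type*} [Semiring R] [AddCommMonoid G]
    [Module R G] [Fintype ι] (L : Combinatorics.Line α ι) (r : ι → R) (v : α → G) {a : α}
    (ha : v a = 0) (b : α) :
    ∑ i, r i • v (L b i) =
      (∑ i with L.idxFun i = none, r i) • v b + ∑ i, r i • v (L a i) := by
  rw [Finset.sum_smul, Finset.sum_filter, ← Finset.sum_add_distrib]
  refine Finset.sum_congr rfl fun i _ => ?_
  cases h : L.idxFun i with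
  | none => simp [h, ha]
  | some c => simp [h]

/-- A finite cover contains a member `U` such that, for some finite set `K` of times, there are
arbitrarily large finite pieces of orbits all of whose points enter `U` at a time in `K`. -/
theorem exists_mem_of_finite_cover {G X : Type*} [AddMonoid G] [Nonempty X] (φ : G → X → X)
    (hadd : ∀ g h : G, ∀ x : X, φ (g + h) x = φ g (φ h x))
    (𝔙 : Finset (Set X)) (hcover : ∀ x, ∃ U ∈ 𝔙, x ∈ U) :
    ∃ U ∈ 𝔙, ∃ K : Finset G, ∀ F : Finset G, ∃ x, ∀ g ∈ F, ∃ k ∈ K, φ (k + g) x ∈ U := by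
  classical
  have hfull : ∀ F : Finset G, ∃ x, ∀ g ∈ F, ∃ U ∈ 𝔙, φ g x ∈ U :=
    fun _ => ⟨Classical.arbitrary X, fun _ _ => hcover _⟩
  obtain ⟨J, hJ𝔙, hJ⟩ := exists_minimal_le_of_wellFoundedLT
    (fun J : Finset (Set X) => ∀ F : Finset G, ∃ x, ∀ g ∈ F, ∃ U ∈ J, φ g x ∈ U) 𝔙 hfull
  obtain ⟨_, hx⟩ := hJ.prop {0}
  obtain ⟨U, hU, -⟩ := hx 0 (Finset.mem_singleton_self 0)
  have herase := hJ.not_prop_of_lt (Finset.erase_ssubset hU)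
  push Not at herase
  obtain ⟨K, hK⟩ := herase
  refine ⟨U, hJ𝔙 hU, K, fun F => ?_⟩
  obtain ⟨x, hx⟩ := hJ.prop ((K ×ˢ F).image fun p => p.1 + p.2)
  refine ⟨x, fun g hg => ?_⟩
  obtain ⟨k, hk, hkU⟩ := hK (φ g x)
  obtain ⟨V, hV, hVx⟩ := hx (k + g)
    (Finset.mem_image_of_mem (fun p : G × G => p.1 + p.2) (Finset.mk_mem_product hk hg))
  refine ⟨k, hk, ?_⟩
  by_cases hVU : V = U
  · exact hVU ▸ hVx
  · exact absurd (hadd k g x ▸ hVx) (hkU V (Finset.mem_erase.mpr ⟨hVU, hV⟩))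

/-- Multiple Recurrence in Open Covers: for a topological dynamical system
`φ : G × X → X` of a semimodule `G` over a discrete semiring `R` on a nonempty compact
Hausdorff space `X` and any open cover `𝔘` of `X`, there is some `U ∈ 𝔘` such that for
any `T₁,…,T_l ∈ G` the hitting-time set `N_{T₁,…,T_l}(U)` is syndetic in `(R,+)`. -/
theorem multiple_recurrence_open_cover {R G X : Type*} [Semiring R] [AddCommMonoid G]
    [Module R G] [TopologicalSpace X] [CompactSpace X] [T2Space X] [Nonempty X]
    (φ : G → X → X)
    (hid : ∀ x : X, φ 0 x = x)
    (hadd : ∀ g h : G, ∀ x : X, φ (g + h) x = φ g (φ h x))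
    (hcont : ∀ g : G, Continuous (φ g))
    (𝔘 : Set (Set X)) (hopen : ∀ U ∈ 𝔘, IsOpen U) (hcover : ⋃₀ 𝔘 = Set.univ) :
    ∃ U ∈ 𝔘, ∀ (l : ℕ) (T : Fin l → G),
      Syndetic {t : R | ∃ x ∈ U, ∀ i : Fin l, φ (t • T i) x ∈ U} := by
  classical
  obtain ⟨I, hI⟩ := isCompact_univ.elim_finite_subcover (fun U : 𝔘 => (U : Set X))
    (fun U => hopen U U.2) (by rw [← Set.sUnion_eq_iUnion, hcover])
  obtain ⟨U, hU, K, hK⟩ := exists_mem_of_finite_cover φ hadd (I.image Subtype.val) fun x => by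
    obtain ⟨V, hV, hxV⟩ := Set.mem_iUnion₂.mp (hI (Set.mem_univ x))
    exact ⟨V, Finset.mem_image_of_mem _ hV, hxV⟩
  obtain ⟨⟨U, hU𝔘⟩, -, rfl⟩ := Finset.mem_image.mp hU
  refine ⟨U, hU𝔘, fun l T => ?_⟩
  by_contra hN
  obtain ⟨ι, _, hι⟩ := Combinatorics.Line.exists_mono_in_high_dimension (Option (Fin l)) K
  obtain ⟨r, hr⟩ := exists_finset_sums_notMem_of_not_syndetic hN (Finset.univ : Finset ι)
  let v : Option (Fin l) → G := fun o => o.elim 0 T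
  let W : (ι → Option (Fin l)) → G := fun w => ∑ i, r i • v (w i)
  obtain ⟨x, hx⟩ := hK (Finset.univ.image W)
  choose C hCK hC using fun w => hx (W w) (Finset.mem_image_of_mem W (Finset.mem_univ w))
  obtain ⟨L, c, hc⟩ := hι fun w => ⟨C w, hCK w⟩
  have hcU (o : Option (Fin l)) : φ (c + W (L o)) x ∈ U := by
    rw [← hc o]
    exact hC (L o)
  obtain ⟨i₀, hi₀⟩ := L.proper
  refine hr {i | L.idxFun i = none} (Finset.subset_univ _) ⟨i₀, by simpa using hi₀⟩
    ⟨φ (c + W (L none)) x, hcU none, fun j => ?_⟩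
  have hW : W (L (some j)) = (∑ i with L.idxFun i = none, r i) • T j + W (L none) :=
    L.sum_smul_apply r v (a := none) rfl (some j)
  rw [← hadd, add_left_comm, ← hW]
  exact hcU (some j)
end

section
/- Let (G,+) be a semimodule over a discrete semiring (R,+,·) and let φ : G × X → X be a topological dynamical system over a compact Hausdorff space X. If p ∈ X is a Bohr almost periodic point of φ, then p is multiply uniformly recurrent for φ; that is, for any T₁,…,T_l ∈ G and any open neighborhood U of p, the set N_{T₁,…,T_l}(p,U) = {t ∈ R : φ(t•Tᵢ, p) ∈ U for every i = 1,…,l} is syndetic in (R,+). -/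
/-- A family of points of `Fin l → X`, `X` compact, is covered up to any entourage by finitely
many of its members. -/
theorem exists_finset_forall_mem_entourage {X ι : Type*} [UniformSpace X] [CompactSpace X]
    {l : ℕ} (x : ι → Fin l → X) {V : Set (X × X)} (hV : V ∈ uniformity X) :
    ∃ F : Finset ι, ∀ t, ∃ s ∈ F, ∀ i, (x t i, x s i) ∈ V := by
  have hD : {q : (Fin l → X) × (Fin l → X) | ∀ i, (q.1 i, q.2 i) ∈ V} ∈
      uniformity (Fin l → X) := by
    have h : ∀ i, {q : (Fin l → X) × (Fin l → X) | (q.1 i, q.2 i) ∈ V} ∈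
        uniformity (Fin l → X) := fun i => Pi.uniformContinuous_proj _ i hV
    simpa only [Set.ofPred_forall] using Filter.iInter_mem.2 h
  have htb : TotallyBounded (Set.range x) :=
    isCompact_univ.totallyBounded.subset (Set.subset_univ _)
  obtain ⟨S, hS, hSfin, hcov⟩ := totallyBounded_iff_subset.1 htb _ hD
  lift S to Finset (Fin l → X) using hSfin
  classical
  rw [← Set.image_univ] at hS
  obtain ⟨F, -, rfl⟩ := Finset.subset_set_image_iff.1 hS
  refine ⟨F, fun t => ?_⟩
  simpa using hcov ⟨t, rfl⟩

section Action

variable {G X : Type*} [AddCommMonoid G] {φ : G → X → X} {p : X} {Y : Set X}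

/-- In a minimal system every orbit returns to every entourage neighbourhood of every point. -/
theorem exists_mem_entourage_of_minimal [UniformSpace X]
    (hid : ∀ x : X, φ 0 x = x)
    (hadd : ∀ g h : G, ∀ x : X, φ (g + h) x = φ g (φ h x))
    (hcont : ∀ g : G, Continuous (φ g)) (hYc : IsClosed Y)
    (hYinv : ∀ g, ∀ y ∈ Y, φ g y ∈ Y)
    (hmin : ∀ Z : Set X, Z ⊆ Y → IsClosed Z → Z.Nonempty →
      (∀ g : G, ∀ z ∈ Z, φ g z ∈ Z) → Z = Y)
    (hp : p ∈ Y) {y : X} (hy : y ∈ Y) {V : Set (X × X)} (hV : V ∈ uniformity X) :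
    ∃ h : G, (p, φ h y) ∈ V := by
  have hZ : closure (Set.range fun g : G => φ g y) = Y := by
    refine hmin _ (closure_minimal ?_ hYc) isClosed_closure
      ⟨y, subset_closure ⟨0, hid y⟩⟩ fun g z hz => ?_
    · rintro _ ⟨g, rfl⟩
      exact hYinv g y hy
    · refine map_mem_closure (hcont g) hz ?_
      rintro _ ⟨h, rfl⟩
      exact ⟨g + h, hadd g h y⟩
  have hpZ : p ∈ closure (Set.range fun g : G => φ g y) := hZ ▸ hp
  obtain ⟨_, hV', h, rfl⟩ := mem_closure_iff_nhds.1 hpZ _ (mem_nhds_left p hV)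
  exact ⟨h, hV'⟩

/-- If the action is equicontinuous and every orbit in `Y` accumulates at `p`, then every time
`s` can be completed to a simultaneous return time `k + s` of `p`. -/
theorem exists_simultaneous_return {R : Type*} [Semiring R] [Module R G]
    [UniformSpace X] [CompactSpace X]
    (hid : ∀ x : X, φ 0 x = x)
    (hadd : ∀ g h : G, ∀ x : X, φ (g + h) x = φ g (φ h x))
    (hYinv : ∀ g, ∀ y ∈ Y, φ g y ∈ Y) (hp : p ∈ Y)
    (hret : ∀ y ∈ Y, ∀ V ∈ uniformity X, ∃ h : G, (p, φ h y) ∈ V)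
    (heq : ∀ V ∈ uniformity X, ∃ V' ∈ uniformity X, ∀ g : G, ∀ y ∈ Y, ∀ z ∈ Y,
      (y, z) ∈ V' → (φ g y, φ g z) ∈ V)
    {l : ℕ} (T : Fin l → G) (s : R) {V : Set (X × X)} (hV : V ∈ uniformity X) :
    ∃ k : R, ∀ i, (p, φ ((k + s) • T i) p) ∈ V := by
  obtain ⟨C, hC, hCsymm, hCV⟩ := comp_symm_mem_uniformity_sets hV
  obtain ⟨A, hA, hAsymm, hAC⟩ := comp_symm_mem_uniformity_sets hC
  obtain ⟨B, hB, hBA⟩ := heq A hA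
  obtain ⟨F, hF⟩ := exists_finset_forall_mem_entourage
    (fun (n : ℕ) i => φ ((n • s) • T i) p) hB
  obtain ⟨m, hm, hclose⟩ := hF (F.sup id + 1)
  have hlt : m ≤ F.sup id := Finset.le_sup (f := id) hm
  obtain ⟨d, hd⟩ : ∃ d : ℕ, F.sup id + 1 = (d + 1) + m := ⟨F.sup id - m, by omega⟩
  rw [hd] at hclose
  refine ⟨d • s, fun i => ?_⟩
  have hmY : φ ((m • s) • T i) p ∈ Y := hYinv _ _ hp
  obtain ⟨h, hh⟩ := hret _ hmY B hB
  have hwY := hYinv h _ hmY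
  have h₁ := hBA 0 _ hp _ hwY hh
  have h₂ := hBA ((d • s + s) • T i) _ hp _ hwY hh
  have h₃ := hBA h _ (hYinv _ _ hp) _ hmY (hclose i)
  rw [hid, hid] at h₁
  have hcomm : φ ((d • s + s) • T i) (φ h (φ ((m • s) • T i) p)) =
      φ h (φ (((d + 1 + m) • s) • T i) p) := by
    simp only [← hadd]
    congr 1
    rw [add_smul (d + 1) m s, add_smul d 1 s, one_smul, add_smul (d • s + s)]
    abel
  rw [hcomm] at h₂
  refine hCV ⟨_, hAC ⟨_, h₁, hAsymm.symm _ _ h₃⟩, ?_⟩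
  exact hCsymm.symm _ _ (hAC ⟨_, h₂, refl_mem_uniformity hA⟩)

end Action

/-- A Bohr almost periodic point of a topological dynamical system `φ : G × X → X` of a
semimodule `G` over a discrete semiring `R` on a compact Hausdorff space `X` is multiply
uniformly recurrent: for any `T₁,…,T_l ∈ G` and any open neighborhood `U` of `p`, the set
`N_{T₁,…,T_l}(p,U) = {t ∈ R : φ(t•Tᵢ,p) ∈ U for i = 1,…,l}` is syndetic in `(R,+)`.

Here `Y` is the orbit closure of `p`; minimality of the restricted action is expressed by
`hmin`, and equicontinuity of `{φ(T,·)|_Y : T ∈ G}` with respect to the unique uniform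
structure of the compact Hausdorff space `Y` is expressed by `hequi` in terms of open
neighborhoods of the diagonal of `Y`. -/
theorem bohr_ap_implies_multiply_uniformly_recurrent {R G X : Type*} [Semiring R]
    [AddCommMonoid G] [Module R G] [TopologicalSpace X] [CompactSpace X] [T2Space X]
    (φ : G → X → X)
    (hid : ∀ x : X, φ 0 x = x)
    (hadd : ∀ g h : G, ∀ x : X, φ (g + h) x = φ g (φ h x))
    (hcont : ∀ g : G, Continuous (φ g))
    (p : X) (Y : Set X) (hY : Y = closure (Set.range fun g : G => φ g p))
    (hmin : ∀ Z : Set X, Z ⊆ Y → IsClosed Z → Z.Nonempty →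
      (∀ g : G, ∀ z ∈ Z, φ g z ∈ Z) → Z = Y)
    (hequi : ∀ W : Set (X × X), IsOpen W → (∀ y ∈ Y, (y, y) ∈ W) →
      ∃ W' : Set (X × X), IsOpen W' ∧ (∀ y ∈ Y, (y, y) ∈ W') ∧
        ∀ g : G, ∀ y ∈ Y, ∀ z ∈ Y, (y, z) ∈ W' → (φ g y, φ g z) ∈ W) :
    ∀ (l : ℕ) (T : Fin l → G) (U : Set X), IsOpen U → p ∈ U →
      Syndetic {t : R | ∀ i : Fin l, φ (t • T i) p ∈ U} := by
  let _ : UniformSpace X := uniformSpaceOfCompactR1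
  have hYc : IsClosed Y := hY ▸ isClosed_closure
  have horb : ∀ g, φ g p ∈ Y := fun g => hY ▸ subset_closure ⟨g, rfl⟩
  have hp : p ∈ Y := hid p ▸ horb 0
  have hYinv : ∀ g, ∀ y ∈ Y, φ g y ∈ Y := by
    intro g y hy
    rw [hY] at hy ⊢
    refine map_mem_closure (hcont g) hy ?_
    rintro _ ⟨h, rfl⟩
    exact ⟨g + h, hadd g h p⟩
  have heq : ∀ V ∈ uniformity X, ∃ V' ∈ uniformity X, ∀ g : G, ∀ y ∈ Y, ∀ z ∈ Y,
      (y, z) ∈ V' → (φ g y, φ g z) ∈ V := by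
    intro V hV
    obtain ⟨W, hWo, hWd, hW⟩ := hequi (interior V) isOpen_interior
      fun y _ => refl_mem_uniformity (interior_mem_uniformity hV)
    refine ⟨W ∪ (Y ×ˢ Y)ᶜ, ?_, fun g y hy z hz hyz => interior_subset (hW g y hy z hz ?_)⟩
    · rw [← nhdsSet_diagonal_eq_uniformity]
      refine (hWo.union (hYc.prod hYc).isOpen_compl).mem_nhdsSet.2 ?_
      rintro ⟨y, z⟩ (rfl : y = z)
      by_cases hy : y ∈ Y
      · exact Or.inl (hWd y hy)
      · exact Or.inr fun h => hy h.1
    · exact hyz.resolve_right fun h => h ⟨hy, hz⟩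
  intro l T U hU hpU
  obtain ⟨V, hV, hVU⟩ := UniformSpace.mem_nhds_iff.1 (hU.mem_nhds hpU)
  obtain ⟨A, hA, hAsymm, hAV⟩ := comp_symm_mem_uniformity_sets hV
  obtain ⟨B, hB, hBA⟩ := heq A hA
  obtain ⟨F, hF⟩ := exists_finset_forall_mem_entourage (fun (t : R) i => φ (t • T i) p) hB
  choose k hk using fun s : R => exists_simultaneous_return hid hadd hYinv hp
    (fun y hy V hV => exists_mem_entourage_of_minimal hid hadd hcont hYc hYinv hmin hp hy hV)
    heq T s hA
  classical
  refine ⟨F.image k, fun t => ?_⟩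
  obtain ⟨s, hs, hts⟩ := hF t
  refine ⟨k s, Finset.mem_image_of_mem k hs, fun i => hVU (hAV ⟨_, hk s i, ?_⟩)⟩
  have h := hBA (k s • T i) _ (horb _) _ (horb _) (hts i)
  rw [← hadd, ← hadd, ← add_smul, ← add_smul] at h
  exact hAsymm.symm _ _ h
end

section
/- Let (G,+) be a semimodule over a discrete semiring (R,+,·), let φ : G × X → X be a topological dynamical system over a compact Hausdorff space X, and let T₁,…,Tₙ ∈ G be such that the restricted action of the sub-semimodule ⟨T₁,…,Tₙ⟩_R = Span_R{T₁,…,Tₙ} on X is minimal. On Xⁿ define, for g ∈ ⟨T₁,…,Tₙ⟩_R, θ^g(x₁,…,xₙ) = (φ(g,x₁),…,φ(g,xₙ)), and for t ∈ R, ξ^t(x₁,…,xₙ) = (φ(t•T₁,x₁),…,φ(t•Tₙ,xₙ)); let 𝔗 = {ξ^t ∘ θ^g : t ∈ R, g ∈ ⟨T₁,…,Tₙ⟩_R} be the resulting commutative family of continuous self-maps of Xⁿ. If Λ ⊆ Xⁿ is a minimal set for the family {θ^g : g ∈ ⟨T₁,…,Tₙ⟩_R} and Σ is the closure in Xⁿ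 of ⋃_{t∈R} ξ^t[Λ], then Σ is a minimal set for 𝔗; that is, Σ is nonempty, closed, invariant under every map in 𝔗, and contains no nonempty proper closed subset invariant under every map in 𝔗. -/
/-- `M` is a minimal set for a family `𝔉` of (continuous) self-maps of `Z`:
`M` is nonempty, closed, invariant under every member of `𝔉`, and contains no
nonempty proper closed subset with these properties. -/
def IsMinimalFor {Z : Type*} [TopologicalSpace Z] (𝔉 : Set (Z → Z)) (M : Set Z) : Prop :=
  M.Nonempty ∧ IsClosed M ∧ (∀ f ∈ 𝔉, Set.MapsTo f M M) ∧
    ∀ M' : Set Z, M' ⊆ M → M'.Nonempty → IsClosed M' →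
      (∀ f ∈ 𝔉, Set.MapsTo f M' M') → M' = M

section RightTopologicalSemigroup

variable {M : Type*} [Semigroup M] [TopologicalSpace M]

theorem mul_mem_closure_of_continuous_mul (hr : ∀ q : M, Continuous (· * q)) {s : Set M}
    (hl : ∀ p ∈ s, Continuous (p * ·)) (hs : ∀ p ∈ s, ∀ q ∈ s, p * q ∈ s) :
    ∀ p ∈ closure s, ∀ q ∈ closure s, p * q ∈ closure s := by
  have h : ∀ p ∈ s, ∀ q ∈ closure s, p * q ∈ closure s := fun p hp q hq =>
    map_mem_closure (hl p hp) hq fun r hr' => hs p hp r hr'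
  intro p hp q hq
  have := map_mem_closure (hr q) hp (t := closure s) fun r hr' => h r hr' q hq
  rwa [closure_closure] at this

variable [CompactSpace M] [T2Space M]

/-- A compact right topological semigroup contains an idempotent `u` of its minimal left ideal:
every idempotent `v` in the left ideal generated by `u` satisfies `u * v = u`. -/
theorem exists_minimal_idempotent (hr : ∀ q : M, Continuous (· * q)) {E : Set M}
    (hne : E.Nonempty) (hE : IsClosed E) (hmul : ∀ p ∈ E, ∀ q ∈ E, p * q ∈ E) :
    ∃ u ∈ E, u * u = u ∧ ∀ v ∈ E, v * u = v → v * v = v → u * v = u := by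
  let 𝓛 : Set (Set M) :=
    {L | IsClosed L ∧ L.Nonempty ∧ L ⊆ E ∧ ∀ p ∈ E, ∀ q ∈ L, p * q ∈ L}
  obtain ⟨L, -, hL⟩ : ∃ L, L ⊆ E ∧ Minimal (· ∈ 𝓛) L := by
    refine zorn_superset_nonempty 𝓛 (fun c hc hchain hcne => ?_) E
      ⟨hE, hne, subset_rfl, hmul⟩
    obtain ⟨t, ht⟩ := hcne
    have : Nonempty c := ⟨⟨t, ht⟩⟩
    refine ⟨⋂₀ c, ⟨isClosed_sInter fun s hs => (hc hs).1, ?_,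
      (Set.sInter_subset_of_mem ht).trans (hc ht).2.2.1, ?_⟩, fun s => Set.sInter_subset_of_mem⟩
    · rw [Set.sInter_eq_iInter]
      exact IsCompact.nonempty_iInter_of_directed_nonempty_isCompact_isClosed _
        (DirectedOn.directed_val (IsChain.directedOn hchain.symm)) (fun s => (hc s.2).2.1)
        (fun s => (hc s.2).1.isCompact) fun s => (hc s.2).1
    · exact fun p hp q hq s hs => (hc hs).2.2.2 p hp q (hq s hs)
  obtain ⟨hLc, hLne, hLE, hLmul⟩ := hL.prop
  obtain ⟨u, hu, huu⟩ := exists_idempotent_in_compact_subsemigroup hr L hLne hLc.isCompact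
    fun p hp q hq => hLmul p (hLE hp) q hq
  refine ⟨u, hLE hu, huu, fun v hv hvu hvv => ?_⟩
  have hvL : v ∈ L := hvu ▸ hLmul v hv u hu
  have hmem : (· * v) '' E ∈ 𝓛 := by
    refine ⟨(hE.isCompact.image (hr v)).isClosed, hne.image _, ?_, ?_⟩
    · rintro _ ⟨p, hp, rfl⟩
      exact hmul p hp v hv
    · rintro p hp _ ⟨q, hq, rfl⟩
      exact ⟨p * q, hmul p hp q hq, mul_assoc p q v⟩
  have hsub : (· * v) '' E ⊆ L := by
    rintro _ ⟨p, hp, rfl⟩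
    exact hLmul p hp v hvL
  obtain ⟨w, -, rfl⟩ := hL.le_of_le hmem hsub hu
  simp only [mul_assoc, hvv]

/-- If `u` is a minimal idempotent of `E`, the diagonal element `(u, …, u)` is minimal in any
compact subsemigroup of the power of `E`. -/
theorem exists_mul_mul_const_eq {ι : Type*} (hr : ∀ q : M, Continuous (· * q)) {E : Set M} {u : M}
    (huu : u * u = u) (hu : ∀ v ∈ E, v * u = v → v * v = v → u * v = u)
    {B : Set (ι → M)} (hB : IsClosed B) (hmul : ∀ p ∈ B, ∀ q ∈ B, p * q ∈ B)
    (hBE : ∀ p ∈ B, ∀ i, p i ∈ E) (huB : (fun _ => u) ∈ B) {p : ι → M} (hp : p ∈ B) :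
    ∃ q ∈ B, q * (p * fun _ => u) = fun _ => u := by
  have hr' : ∀ q : ι → M, Continuous (· * q) := fun q =>
    continuous_pi fun i => (hr (q i)).comp (continuous_apply i)
  set d : ι → M := fun _ => u
  have hpd : p * d ∈ B := hmul p hp d huB
  obtain ⟨v, ⟨q, hq, hqv⟩, hvv⟩ := exists_idempotent_in_compact_subsemigroup hr'
    ((· * (p * d)) '' B) (Set.Nonempty.image _ ⟨p, hp⟩) (hB.isCompact.image (hr' _)) (by
      rintro _ ⟨a, ha, rfl⟩ _ ⟨b, hb, rfl⟩
      exact ⟨a * (p * d) * b, hmul _ (hmul a ha _ hpd) b hb, mul_assoc _ _ _⟩)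
  have hvB : v ∈ B := hqv ▸ hmul q hq _ hpd
  have hdd : d * d = d := funext fun _ => huu
  have hvd : v * d = v := by simp only [← hqv, mul_assoc, hdd]
  refine ⟨d * q, hmul d huB q hq, ?_⟩
  rw [mul_assoc]
  simp only at hqv
  rw [hqv]
  exact funext fun i => hu (v i) (hBE v hvB i) (congrFun hvd i) (congrFun hvv i)

end RightTopologicalSemigroup

section Ellis

variable {X : Type*} [TopologicalSpace X]

/-- The topology of pointwise convergence on self-maps. -/
instance : TopologicalSpace (Function.End X) := inferInstanceAs (TopologicalSpace (X → X))

instance [CompactSpace X] : CompactSpace (Function.End X) :=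
  inferInstanceAs (CompactSpace (X → X))

instance [T2Space X] : T2Space (Function.End X) := inferInstanceAs (T2Space (X → X))

theorem Function.End.continuous_apply (x : X) : Continuous fun p : Function.End X => p x :=
  _root_.continuous_apply (A := fun _ : X => X) x

theorem Function.End.continuous_mul_right (q : Function.End X) : Continuous (· * q) :=
  continuous_pi (A := fun _ : X => X) fun x => Function.End.continuous_apply (q x)

theorem Function.End.continuous_mul_left {p : Function.End X} (hp : Continuous (p : X → X)) :
    Continuous (p * ·) :=
  continuous_pi (A := fun _ : X => X) fun x => hp.comp (Function.End.continuous_apply x)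

end Ellis

/-- Ellis-type lemma: let `φ : G × X → X` be a topological dynamical system of a
semimodule `G` over a discrete semiring `R` on a compact Hausdorff space `X`, and let
`T₁,…,Tₙ ∈ G` be such that the action of `⟨T₁,…,Tₙ⟩_R = Span_R{T₁,…,Tₙ}` on `X` is
minimal.  On `Xⁿ` let `θ^g` (for `g ∈ ⟨T₁,…,Tₙ⟩_R`) act diagonally by `φ g` and let
`ξ^t` (for `t ∈ R`) act by `φ (t•Tᵢ)` in the `i`-th coordinate, and let
`𝔗 = {ξ^t ∘ θ^g}`.  If `Λ` is minimal for `{θ^g}` and `Σ` is the closure of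
`⋃_{t∈R} ξ^t[Λ]`, then `Σ` is a minimal set for `𝔗`. -/
theorem ellis_lemma {R G X : Type*} [Semiring R] [AddCommMonoid G] [Module R G]
    [TopologicalSpace X] [CompactSpace X] [T2Space X]
    (φ : G → X → X)
    (hid : ∀ x : X, φ 0 x = x)
    (hadd : ∀ g h : G, ∀ x : X, φ (g + h) x = φ g (φ h x))
    (hcont : ∀ g : G, Continuous (φ g))
    {n : ℕ} (T : Fin n → G)
    (hmin : IsMinimalFor {f : X → X | ∃ g ∈ Submodule.span R (Set.range T), f = φ g}
      Set.univ)
    (Λ : Set (Fin n → X))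
    (hΛ : IsMinimalFor
      {f : (Fin n → X) → (Fin n → X) | ∃ g ∈ Submodule.span R (Set.range T),
        f = fun xs => fun i => φ g (xs i)} Λ)
    (S : Set (Fin n → X))
    (hS : S = closure (⋃ t : R, (fun xs : Fin n → X => fun i => φ (t • T i) (xs i)) '' Λ)) :
    IsMinimalFor
      {f : (Fin n → X) → (Fin n → X) | ∃ t : R, ∃ g ∈ Submodule.span R (Set.range T),
        f = (fun xs : Fin n → X => fun i => φ (t • T i) (xs i)) ∘
          (fun xs : Fin n → X => fun i => φ g (xs i))} S := by
  obtain ⟨⟨x₀, hx₀⟩, hΛc, hΛinv, hΛmin⟩ := hΛ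
  set V := Submodule.span R (Set.range T)
  have hcontPi : ∀ g : Fin n → G, Continuous fun (xs : Fin n → X) i => φ (g i) (xs i) := fun g =>
    continuous_pi fun i => (hcont (g i)).comp (continuous_apply i)
  have hΛS : Λ ⊆ S := fun x hx => hS ▸ subset_closure
    (Set.mem_iUnion.2 ⟨0, x, hx, by simp [hid]⟩)
  have hTV : ∀ t : R, ∀ i, t • T i ∈ V := fun t i =>
    V.smul_mem t (Submodule.subset_span ⟨i, rfl⟩)
  have hSsub : ∀ N : Set (Fin n → X), IsClosed N →
      (∀ t : R, ∀ g ∈ V, ∀ y ∈ N, (fun i => φ (t • T i) (φ g (y i))) ∈ N) →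
      (N ∩ Λ).Nonempty → S ⊆ N := by
    intro N hN hNinv hNΛ
    have hΛN : N ∩ Λ = Λ := by
      refine hΛmin _ Set.inter_subset_right hNΛ (hN.inter hΛc) ?_
      rintro _ ⟨g, hg, rfl⟩ y ⟨hyN, hyΛ⟩
      refine ⟨?_, hΛinv _ ⟨g, hg, rfl⟩ hyΛ⟩
      simpa [hid] using hNinv 0 g hg y hyN
    rw [hS]
    refine closure_minimal (Set.iUnion_subset fun t => ?_) hN
    rintro _ ⟨y, hy, rfl⟩
    simpa [hid] using hNinv t 0 V.zero_mem y (hΛN.symm ▸ hy : y ∈ N ∩ Λ).1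
  let E₀ : Set (Function.End X) := {f | ∃ g ∈ V, f = φ g}
  let B₀ : Set (Fin n → Function.End X) :=
    {f | ∃ t : R, ∃ g ∈ V, f = fun i => φ (t • T i + g)}
  have hEmul := mul_mem_closure_of_continuous_mul Function.End.continuous_mul_right (s := E₀)
    (by rintro _ ⟨g, -, rfl⟩; exact Function.End.continuous_mul_left (hcont g))
    (by
      rintro _ ⟨g, hg, rfl⟩ _ ⟨h, hh, rfl⟩
      exact ⟨g + h, V.add_mem hg hh, funext fun x => (hadd g h x).symm⟩)
  have hBmul := mul_mem_closure_of_continuous_mul (s := B₀)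
    (fun q => continuous_pi fun i =>
      (Function.End.continuous_mul_right (q i)).comp (continuous_apply i))
    (by
      rintro _ ⟨t, g, -, rfl⟩
      exact continuous_pi fun i =>
        (Function.End.continuous_mul_left (hcont _)).comp (continuous_apply i))
    (by
      rintro _ ⟨s, g, hg, rfl⟩ _ ⟨t, h, hh, rfl⟩
      refine ⟨s + t, g + h, V.add_mem hg hh, funext fun i => funext fun x => ?_⟩
      rw [add_smul, add_add_add_comm]
      exact (hadd _ _ x).symm)
  have hBE : ∀ p ∈ closure B₀, ∀ i, p i ∈ closure E₀ := fun p hp i =>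
    map_mem_closure (f := fun p : Fin n → Function.End X => p i) (continuous_apply i) hp (by
      rintro _ ⟨t, g, hg, rfl⟩
      exact ⟨_, V.add_mem (hTV t i) hg, rfl⟩)
  have hEB : ∀ p ∈ closure E₀, (fun _ => p : Fin n → Function.End X) ∈ closure B₀ := fun p hp =>
    map_mem_closure (f := fun p (_ : Fin n) => p) (continuous_pi fun _ => continuous_id) hp (by
      rintro _ ⟨g, hg, rfl⟩
      exact ⟨0, g, hg, funext fun i => by rw [zero_smul, zero_add]⟩)
  have heval : ∀ y : Fin n → X,
      Continuous fun (p : Fin n → Function.End X) i => p i (y i) := fun y =>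
    continuous_pi fun i => (Function.End.continuous_apply (y i)).comp (continuous_apply i)
  obtain ⟨u, huE, huu, humin⟩ := exists_minimal_idempotent Function.End.continuous_mul_right
    (E := closure E₀) ⟨φ 0, subset_closure ⟨0, V.zero_mem, rfl⟩⟩ isClosed_closure hEmul
  have huB := hEB u huE
  let x : Fin n → X := fun i => u (x₀ i)
  have hux : ∀ i, u (x i) = x i := fun i => congrFun huu (x₀ i)
  have hxΛ : x ∈ Λ := by
    have := map_mem_closure (t := Λ)
      ((heval x₀).comp (continuous_pi fun _ => continuous_id)) huE (by
        rintro _ ⟨g, hg, rfl⟩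
        exact hΛinv _ ⟨g, hg, rfl⟩ hx₀)
    rwa [hΛc.closure_eq] at this
  have horbit : S ⊆ (fun p i => p i (x i)) '' closure B₀ := by
    refine hSsub _ (isClosed_closure.isCompact.image (heval x)).isClosed ?_
      ⟨x, ⟨fun _ => u, huB, funext hux⟩, hxΛ⟩
    rintro t g hg _ ⟨p, hp, rfl⟩
    exact ⟨_, hBmul _ (subset_closure ⟨t, g, hg, rfl⟩) p hp, funext fun i => hadd _ _ _⟩
  refine ⟨⟨x₀, hΛS hx₀⟩, hS ▸ isClosed_closure, ?_, ?_⟩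
  · rintro _ ⟨t, g, hg, rfl⟩
    rw [hS]
    refine Set.MapsTo.closure ?_ ((hcontPi _).comp (hcontPi _))
    intro y hy
    obtain ⟨s, z, hz, rfl⟩ := Set.mem_iUnion.1 hy
    refine Set.mem_iUnion.2 ⟨t + s, _, hΛinv _ ⟨g, hg, rfl⟩ hz, funext fun i => ?_⟩
    simp only [Function.comp_apply, ← hadd, add_smul]
    congr 1
    abel
  · intro N hNS ⟨y, hy⟩ hN hNinv
    have hNinv' : ∀ t : R, ∀ g ∈ V, ∀ y ∈ N, (fun i => φ (t • T i) (φ g (y i))) ∈ N :=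
      fun t g hg y hy => hNinv _ ⟨t, g, hg, rfl⟩ hy
    obtain ⟨p, hp, rfl⟩ := horbit (hNS hy)
    obtain ⟨q, hq, hqpu⟩ := exists_mul_mul_const_eq Function.End.continuous_mul_right huu humin
      isClosed_closure hBmul hBE huB hp
    have hqN := map_mem_closure (t := N) (heval _) hq (by
      rintro _ ⟨t, g, hg, rfl⟩
      simpa only [hadd] using hNinv' t g hg _ hy)
    rw [hN.closure_eq] at hqN
    refine hNS.antisymm (hSsub N hN hNinv' ⟨x, ?_, hxΛ⟩)
    convert hqN using 2 with i
    have h : q i (p i (u (x i))) = u (x i) := congrFun (congrFun hqpu i) (x i)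
    rw [hux] at h
    exact h.symm
end

section
/- Let X be a compact Hausdorff space and let φ : ℝ≥0 × X → X be a jointly continuous semiflow, i.e. φ is continuous on the product space (with the Euclidean topology on ℝ≥0), φ(0,x) = x, and φ(s + t, x) = φ(s, φ(t,x)) for all s,t ≥ 0 and x ∈ X. Suppose x₀ ∈ X is uniformly recurrent for φ: for every open neighborhood U of x₀ the set {t ∈ ℝ≥0 : φ(t,x₀) ∈ U} is syndetic in (ℝ≥0,+). Then for every τ > 0, the point x₀ is uniformly recurrent for the τ-sample map x ↦ φ(τ,x): for every open neighborhood U of x₀ the set {n ∈ ℕ : φ(nτ, x₀) ∈ U} is syndetic in (ℕ,+). -/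
open scoped NNReal

/-- A nonempty closed forward-invariant set in a compact space contains a minimal one. -/
theorem exists_minimal_closed_mapsTo {X : Type*} [TopologicalSpace X] [CompactSpace X]
    {f : X → X} {C : Set X} (hC : IsClosed C) (hne : C.Nonempty) (hinv : Set.MapsTo f C C) :
    ∃ M ⊆ C, Minimal (fun M : Set X => IsClosed M ∧ M.Nonempty ∧ Set.MapsTo f M M) M := by
  refine zorn_superset_nonempty {M : Set X | IsClosed M ∧ M.Nonempty ∧ Set.MapsTo f M M}
    (fun c hc hchain hcne => ⟨⋂₀ c, ⟨isClosed_sInter fun M hM => (hc hM).1, ?_, ?_⟩,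
      fun M hM => Set.sInter_subset_of_mem hM⟩) C ⟨hC, hne, hinv⟩
  · have : Nonempty c := hcne.to_subtype
    exact IsCompact.nonempty_sInter_of_directed_nonempty_isCompact_isClosed
      (fun A hA B hB => (hchain.total hA hB).elim (fun h => ⟨A, hA, subset_rfl, h⟩)
        fun h => ⟨B, hB, h, subset_rfl⟩) (fun M hM => (hc hM).2.1) (fun M hM => (hc hM).1.isCompact)
      (fun M hM => (hc hM).1)
  · exact fun x hx M hM => (hc hM).2.2 (hx M hM)

/-- In a minimal set, the orbits enter any open set that meets it within a uniformly bounded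
time. -/
theorem exists_finset_iterate_mem_of_minimal {X : Type*} [TopologicalSpace X] [CompactSpace X]
    {f : X → X} (hf : Continuous f) {M : Set X}
    (hM : Minimal (fun M : Set X => IsClosed M ∧ M.Nonempty ∧ Set.MapsTo f M M) M)
    {U : Set X} (hU : IsOpen U) (hMU : (M ∩ U).Nonempty) :
    ∃ K : Finset ℕ, ∀ z ∈ M, ∃ k ∈ K, f^[k] z ∈ U := by
  obtain ⟨hclosed, -, hinv⟩ := hM.prop
  have hcover : M ⊆ ⋃ k : ℕ, f^[k] ⁻¹' U := by
    intro z hz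
    by_contra hzU
    have hle : M ⊆ M ∩ ⋂ k : ℕ, f^[k] ⁻¹' Uᶜ := by
      refine hM.le_of_le ⟨hclosed.inter (isClosed_iInter fun k =>
        hU.isClosed_compl.preimage (hf.iterate k)), ⟨z, hz, by simpa using hzU⟩, ?_⟩
        Set.inter_subset_left
      rintro w ⟨hw, hwU⟩
      refine ⟨hinv hw, Set.mem_iInter.2 fun k => ?_⟩
      exact Set.mem_iInter.1 hwU (k + 1)
    obtain ⟨y, hy, hyU⟩ := hMU
    exact Set.mem_iInter.1 (hle hy).2 0 hyU
  obtain ⟨K, hK⟩ := hclosed.isCompact.elim_finite_subcover _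
    (fun k => hU.preimage (hf.iterate k)) hcover
  exact ⟨K, fun z hz => by simpa using hK hz⟩

/-- A uniformly recurrent point belongs to every nonempty closed forward-invariant subset of its
orbit closure. -/
theorem mem_of_isClosed_of_subset_orbit_closure {X T : Type*} [TopologicalSpace X]
    [RegularSpace X] [AddCommMonoid T] {φ : T × X → X} (hφ : ∀ t, Continuous fun x => φ (t, x))
    (hadd : ∀ s t : T, ∀ x : X, φ (s + t, x) = φ (s, φ (t, x))) {x₀ : X}
    (hur : ∀ U : Set X, IsOpen U → x₀ ∈ U →
      ∃ K : Finset T, ∀ g : T, ∃ k ∈ K, φ (g + k, x₀) ∈ U)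
    {C : Set X} (hC : IsClosed C) (hne : C.Nonempty) (hinv : ∀ t, ∀ z ∈ C, φ (t, z) ∈ C)
    (hsub : C ⊆ closure (Set.range fun t => φ (t, x₀))) : x₀ ∈ C := by
  by_contra hx
  obtain ⟨V, hV, hVclosed, hVC⟩ :=
    exists_mem_nhds_isClosed_subset (hC.isOpen_compl.mem_nhds hx)
  obtain ⟨K, hK⟩ := hur (interior V) isOpen_interior (mem_interior_iff_mem_nhds.2 hV)
  have hclosure : closure (Set.range fun t => φ (t, x₀)) ⊆
      ⋃ k ∈ K, (fun x => φ (k, x)) ⁻¹' V := by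
    refine closure_minimal ?_ (K.finite_toSet.isClosed_biUnion fun k _ => hVclosed.preimage (hφ k))
    rintro _ ⟨g, rfl⟩
    obtain ⟨k, hk, hkV⟩ := hK g
    refine Set.mem_biUnion hk ?_
    rw [add_comm, hadd] at hkV
    exact (interior_subset hkV : φ (k, φ (g, x₀)) ∈ V)
  obtain ⟨z, hz⟩ := hne
  obtain ⟨k, -, hkV⟩ := Set.mem_iUnion₂.1 (hclosure (hsub hz))
  exact hVC hkV (hinv k z hz)

/-- Iterating the `τ`-sample map `n` times is flowing for time `n * τ`. -/
theorem iterate_sample_map {X : Type*} {φ : ℝ≥0 × X → X} (hid : ∀ x : X, φ (0, x) = x)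
    (hadd : ∀ s t : ℝ≥0, ∀ x : X, φ (s + t, x) = φ (s, φ (t, x))) (τ : ℝ≥0) (n : ℕ) (x : X) :
    (fun x => φ (τ, x))^[n] x = φ (n * τ, x) := by
  induction n with
  | zero => simp [hid]
  | succ n ih =>
    rw [Function.iterate_succ_apply', ih, ← hadd]
    congr 2
    push_cast
    ring

/-- If `x₀` is uniformly recurrent for a jointly continuous semiflow
`φ : ℝ≥0 × X → X` on a compact Hausdorff space `X`, then for every `τ > 0`, `x₀` is
uniformly recurrent for the `τ`-sample map `x ↦ φ(τ,x)`.  Syndeticity in `(ℝ≥0,+)` and in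
`(ℕ,+)` is expressed with respect to the discrete structure: a set `N` is syndetic if
there is a finite set `K` with `N ∩ (g + K) ≠ ∅` for every `g`. -/
theorem sample_map_uniformly_recurrent {X : Type*} [TopologicalSpace X] [CompactSpace X]
    [T2Space X]
    (φ : ℝ≥0 × X → X) (hφcont : Continuous φ)
    (hid : ∀ x : X, φ (0, x) = x)
    (hadd : ∀ s t : ℝ≥0, ∀ x : X, φ (s + t, x) = φ (s, φ (t, x)))
    (x₀ : X)
    (hur : ∀ U : Set X, IsOpen U → x₀ ∈ U →
      ∃ K : Finset ℝ≥0, ∀ g : ℝ≥0, ∃ k ∈ K, φ (g + k, x₀) ∈ U) :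
    ∀ τ : ℝ≥0, 0 < τ → ∀ U : Set X, IsOpen U → x₀ ∈ U →
      ∃ K : Finset ℕ, ∀ n : ℕ, ∃ k ∈ K, φ (((n + k : ℕ) : ℝ≥0) * τ, x₀) ∈ U := by
  intro τ hτ U hU hxU
  have hφ : ∀ t, Continuous fun x => φ (t, x) := fun t => by fun_prop
  have hiter := iterate_sample_map hid hadd τ
  have horbit : ∀ t, ∀ z ∈ closure (Set.range fun t => φ (t, x₀)),
      φ (t, z) ∈ closure (Set.range fun t => φ (t, x₀)) := by
    intro t
    refine Set.MapsTo.closure (f := fun z => φ (t, z)) ?_ (hφ t)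
    rintro _ ⟨s, rfl⟩
    exact ⟨t + s, hadd t s x₀⟩
  obtain ⟨M, hMsub, hM⟩ := exists_minimal_closed_mapsTo (f := fun x => φ (τ, x))
    isClosed_closure (Set.range_nonempty fun t => φ (t, x₀)).closure (horbit τ)
  obtain ⟨hMclosed, ⟨m, hm⟩, hMinv⟩ := hM.prop
  have hMiter : ∀ n : ℕ, ∀ z ∈ M, φ (n * τ, z) ∈ M := fun n z hz =>
    hiter n z ▸ hMinv.iterate n hz
  obtain ⟨⟨s, y⟩, ⟨-, hy⟩, hsy⟩ : x₀ ∈ φ '' (Set.Icc 0 τ ×ˢ M) := by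
    refine mem_of_isClosed_of_subset_orbit_closure hφ hadd hur
      ((isCompact_Icc.prod hMclosed.isCompact).image hφcont).isClosed
      ⟨_, (0, m), ⟨⟨le_rfl, hτ.le⟩, hm⟩, rfl⟩ ?_ ?_
    · rintro t _ ⟨⟨s, z⟩, ⟨-, hz⟩, rfl⟩
      have hle : (⌊(t + s) / τ⌋₊ : ℝ≥0) * τ ≤ t + s :=
        (le_div_iff₀ hτ).1 (Nat.floor_le zero_le)
      have hlt : t + s < (⌊(t + s) / τ⌋₊ + 1) * τ :=
        (div_lt_iff₀ hτ).1 (Nat.lt_floor_add_one _)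
      refine ⟨(t + s - ⌊(t + s) / τ⌋₊ * τ, φ (⌊(t + s) / τ⌋₊ * τ, z)),
        ⟨⟨zero_le, ?_⟩, hMiter _ z hz⟩, ?_⟩
      · rw [tsub_le_iff_left]
        exact hlt.le.trans_eq (by ring)
      · rw [← hadd, ← hadd, tsub_add_cancel_of_le hle]
    · rintro _ ⟨⟨s, z⟩, ⟨-, hz⟩, rfl⟩
      exact horbit s z (hMsub hz)
  obtain ⟨K, hK⟩ := exists_finset_iterate_mem_of_minimal (hφ τ) hM (hU.preimage (hφ s))
    ⟨y, hy, show φ (s, y) ∈ U from hsy ▸ hxU⟩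
  refine ⟨K, fun n => ?_⟩
  obtain ⟨k, hk, hkU⟩ := hK _ (hMiter n y hy)
  refine ⟨k, hk, ?_⟩
  rw [hiter, Set.mem_preimage, ← hadd, ← hadd] at hkU
  rw [← hsy, ← hadd]
  convert hkU using 3
  push_cast
  ring
end

section
/- Let X be a compact Hausdorff space, d ≥ 1, and let φ : (ℝ≥0)^d × X → X be a jointly continuous semiflow, i.e. φ is continuous on the product space (with the Euclidean topology on (ℝ≥0)^d), φ(0,x) = x, and φ(s + t, x) = φ(s, φ(t,x)) for all s,t ∈ (ℝ≥0)^d and x ∈ X. If x₀ ∈ X is uniformly recurrent for φ (for every open neighborhood U of x₀ the set {t ∈ (ℝ≥0)^d : φ(t,x₀) ∈ U} is syndetic in ((ℝ≥0)^d,+)), then x₀ is uniformly recurrent for the restricted action φ : ℕ^d × X → X (for every open neighborhood U of x₀ the set {n ∈ ℕ^d : φ(n,x₀) ∈ U} is syndetic in (ℕ^d,+)). -/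
open scoped NNReal

/-- A set that is nonempty, closed and invariant under every map of the family `f`. -/
def IsClosedInvariant {S X : Type*} [TopologicalSpace X] (f : S → X → X) (M : Set X) : Prop :=
  M.Nonempty ∧ IsClosed M ∧ ∀ s, ∀ x ∈ M, f s x ∈ M

theorem IsClosedInvariant.exists_minimal_subset {S X : Type*} [TopologicalSpace X]
    [CompactSpace X] {f : S → X → X} {Y : Set X} (hY : IsClosedInvariant f Y) :
    ∃ M ⊆ Y, Minimal (IsClosedInvariant f) M := by
  obtain ⟨M, hMY, hM⟩ := zorn_superset_nonempty {M | IsClosedInvariant f M}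
      (fun c hc hchain hne ↦ by
    refine ⟨⋂₀ c, ⟨?_, ?_, ?_⟩, fun s hs ↦ Set.sInter_subset_of_mem hs⟩
    · have : Nonempty c := hne.to_subtype
      have hdir : DirectedOn (· ⊇ ·) c := fun s hs t ht ↦ by
        obtain h | h := hchain.total hs ht
        exacts [⟨s, hs, subset_rfl, h⟩, ⟨t, ht, h, subset_rfl⟩]
      exact IsCompact.nonempty_sInter_of_directed_nonempty_isCompact_isClosed hdir
        (fun s hs ↦ (hc hs).1) (fun s hs ↦ (hc hs).2.1.isCompact) (fun s hs ↦ (hc hs).2.1)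
    · exact isClosed_sInter fun s hs ↦ (hc hs).2.1
    · exact fun s x hx M hM ↦ (hc hM).2.2 s x (hx M hM)) Y hY
  exact ⟨M, hMY, hM⟩

section AddMonoidAction

variable {S X : Type*} [AddCommMonoid S] [TopologicalSpace X] {f : S → X → X}

theorem isClosedInvariant_closure_orbit (hf : ∀ s, Continuous (f s))
    (hadd : ∀ s t x, f (s + t) x = f s (f t x)) (x : X) :
    IsClosedInvariant f (closure (Set.range fun s ↦ f s x)) := by
  refine ⟨⟨_, subset_closure ⟨0, rfl⟩⟩, isClosed_closure, fun s y hy ↦ ?_⟩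
  refine map_mem_closure (hf s) hy ?_
  rintro _ ⟨t, rfl⟩
  exact ⟨s + t, hadd s t x⟩

/-- Points of a minimal set are uniformly recurrent. -/
theorem Minimal.exists_finset_forall_mem [CompactSpace X] (hf : ∀ s, Continuous (f s))
    (hadd : ∀ s t x, f (s + t) x = f s (f t x)) {M : Set X}
    (hM : Minimal (IsClosedInvariant f) M) {m : X} (hm : m ∈ M) {V : Set X} (hV : IsOpen V)
    (hmV : m ∈ V) : ∃ K : Finset S, ∀ s, ∃ k ∈ K, f (s + k) m ∈ V := by
  have hcover : M ⊆ ⋃ s, f s ⁻¹' V := by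
    intro y hy
    have horb : closure (Set.range fun s ↦ f s y) ⊆ M :=
      hM.prop.2.1.closure_subset_iff.2 (Set.range_subset_iff.2 fun s ↦ hM.prop.2.2 s y hy)
    have hmem := hM.le_of_le (isClosedInvariant_closure_orbit hf hadd y) horb hm
    obtain ⟨_, hV', s, rfl⟩ := mem_closure_iff.1 hmem V hV hmV
    exact Set.mem_iUnion.2 ⟨s, hV'⟩
  obtain ⟨K, hK⟩ :=
    hM.prop.2.1.isCompact.elim_finite_subcover _ (fun s ↦ hV.preimage (hf s)) hcover
  refine ⟨K, fun s ↦ ?_⟩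
  obtain ⟨k, hk, hkV⟩ := Set.mem_iUnion₂.1 (hK (hM.prop.2.2 s m hm))
  exact ⟨k, hk, by rwa [add_comm, hadd]⟩

/-- A uniformly recurrent point lies in every closed invariant subset of its orbit closure. -/
theorem IsClosedInvariant.mem_of_subset_closure_orbit [RegularSpace X]
    (hf : ∀ s, Continuous (f s)) (hadd : ∀ s t x, f (s + t) x = f s (f t x)) {x : X}
    (hx : ∀ U : Set X, IsOpen U → x ∈ U → ∃ K : Finset S, ∀ s, ∃ k ∈ K, f (s + k) x ∈ U)
    {Z : Set X} (hZ : IsClosedInvariant f Z) (hZx : Z ⊆ closure (Set.range fun s ↦ f s x)) :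
    x ∈ Z := by
  by_contra hxZ
  obtain ⟨C, hC, hCclosed, hCZ⟩ :=
    exists_mem_nhds_isClosed_subset (hZ.2.1.isOpen_compl.mem_nhds hxZ)
  obtain ⟨K, hK⟩ := hx (interior C) isOpen_interior (mem_interior_iff_mem_nhds.2 hC)
  have hclosed : IsClosed (⋃ k ∈ K, f k ⁻¹' C) :=
    K.finite_toSet.isClosed_biUnion fun k _ ↦ hCclosed.preimage (hf k)
  have hsub : closure (Set.range fun s ↦ f s x) ⊆ ⋃ k ∈ K, f k ⁻¹' C := by
    refine hclosed.closure_subset_iff.2 (Set.range_subset_iff.2 fun s ↦ ?_)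
    obtain ⟨k, hk, hkC⟩ := hK s
    rw [add_comm, hadd] at hkC
    exact Set.mem_iUnion₂.2 ⟨k, hk, Set.mem_preimage.2 (interior_subset hkC)⟩
  obtain ⟨z, hz⟩ := hZ.1
  obtain ⟨k, -, hkC⟩ := Set.mem_iUnion₂.1 (hsub (hZx hz))
  exact hCZ hkC (hZ.2.2 k z hz)

end AddMonoidAction

/-- If `x₀` is uniformly recurrent for a jointly continuous semiflow
`φ : (ℝ≥0)^d × X → X` on a compact Hausdorff space `X`, then `x₀` is uniformly recurrent
for the restricted action of `ℕ^d` (embedded naturally in `(ℝ≥0)^d`).  Syndeticity in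
`((ℝ≥0)^d,+)` and in `(ℕ^d,+)` is expressed with respect to the discrete structure: a set
`N` is syndetic if there is a finite set `K` with `N ∩ (g + K) ≠ ∅` for every `g`. -/
theorem multidim_sample_uniformly_recurrent {X : Type*} [TopologicalSpace X]
    [CompactSpace X] [T2Space X] {d : ℕ} (hd : 1 ≤ d)
    (φ : (Fin d → ℝ≥0) × X → X) (hφcont : Continuous φ)
    (hid : ∀ x : X, φ (0, x) = x)
    (hadd : ∀ s t : Fin d → ℝ≥0, ∀ x : X, φ (s + t, x) = φ (s, φ (t, x)))
    (x₀ : X)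
    (hur : ∀ U : Set X, IsOpen U → x₀ ∈ U →
      ∃ K : Finset (Fin d → ℝ≥0), ∀ g : Fin d → ℝ≥0, ∃ k ∈ K, φ (g + k, x₀) ∈ U) :
    ∀ U : Set X, IsOpen U → x₀ ∈ U →
      ∃ K : Finset (Fin d → ℕ), ∀ n : Fin d → ℕ, ∃ k ∈ K,
        φ (fun i => (((n + k) i : ℕ) : ℝ≥0), x₀) ∈ U := by
  intro U hU hxU
  have hf : ∀ t, Continuous fun x ↦ φ (t, x) := fun t ↦ by fun_prop
  let ι : (Fin d → ℕ) → Fin d → ℝ≥0 := fun n i ↦ n i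
  have hι : ∀ m n, ι (m + n) = ι m + ι n := fun m n ↦ by ext i; simp [ι]
  have haddι : ∀ m n x, φ (ι (m + n), x) = φ (ι m, φ (ι n, x)) := fun m n x ↦ by
    rw [hι, hadd]
  have hY := isClosedInvariant_closure_orbit (f := fun t x ↦ φ (t, x)) hf hadd x₀
  obtain ⟨M, hMY, hM⟩ := IsClosedInvariant.exists_minimal_subset (f := fun n x ↦ φ (ι n, x))
    ⟨hY.1, hY.2.1, fun n ↦ hY.2.2 (ι n)⟩
  have hZ : IsClosedInvariant (fun t x ↦ φ (t, x)) (φ '' (Set.Icc 0 1 ×ˢ M)) := by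
    refine ⟨?_, ?_, ?_⟩
    · exact ((Set.nonempty_Icc.2 zero_le_one).prod hM.prop.1).image φ
    · exact ((isCompact_Icc.prod hM.prop.2.1.isCompact).image hφcont).isClosed
    · rintro t _ ⟨⟨r, m⟩, ⟨-, hm⟩, rfl⟩
      let n : Fin d → ℕ := fun i ↦ ⌊(t + r) i⌋₊
      have hn : ι n ≤ t + r := fun i ↦ Nat.floor_le zero_le
      refine ⟨(t + r - ι n, φ (ι n, m)), ⟨⟨fun i ↦ zero_le, ?_⟩, hM.prop.2.2 n m hm⟩, ?_⟩
      · exact fun i ↦ tsub_le_iff_left.2 (Nat.lt_floor_add_one ((t + r) i)).le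
      · rw [← hadd, tsub_add_cancel_of_le hn, hadd]
  have hZY : φ '' (Set.Icc 0 1 ×ˢ M) ⊆ closure (Set.range fun t ↦ φ (t, x₀)) := by
    rintro _ ⟨⟨r, m⟩, ⟨-, hm⟩, rfl⟩
    exact hY.2.2 r m (hMY hm)
  obtain ⟨⟨r, m⟩, ⟨-, hm⟩, rfl⟩ := hZ.mem_of_subset_closure_orbit hf hadd hur hZY
  obtain ⟨K, hK⟩ := hM.exists_finset_forall_mem (fun n ↦ hf (ι n)) haddι hm
    (hU.preimage (hf r)) hxU
  refine ⟨K, fun n ↦ ?_⟩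
  obtain ⟨k, hk, hkU⟩ := hK n
  refine ⟨k, hk, ?_⟩
  change φ (ι (n + k), φ (r, m)) ∈ U
  rwa [← hadd, add_comm, hadd]
end

section
/- Let p(x) = a_d x^d + ⋯ + a₁ x + a₀ be a real polynomial with d ≥ 1 and a_d ≠ 0. Then the values p(x), x ≥ 0, are equidistributed modulo one in the following sense: for every continuous function f : ℝ/ℤ → ℝ, lim_{T→+∞} (1/T) ∫₀^T f(p(x) mod 1) dx = ∫_{ℝ/ℤ} f dμ, where μ is the Haar probability measure on the circle ℝ/ℤ (equivalently ∫₀¹ f(θ) dθ). -/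
open MeasureTheory intervalIntegral

open Filter Topology Polynomial

/-- A function on the half-line whose derivative tends to zero is `o(T)`. -/
lemma tendsto_inv_smul_of_deriv_tendsto_zero {E : Type*} [NormedAddCommGroup E]
    [NormedSpace ℝ E] {F F' : ℝ → E} (hF : ∀ᶠ x in atTop, HasDerivAt F (F' x) x)
    (hF' : Tendsto F' atTop (𝓝 0)) :
    Tendsto (fun T : ℝ => T⁻¹ • F T) atTop (𝓝 0) := by
  rw [Metric.tendsto_nhds]
  intro ε hε
  have h1 : ∀ᶠ x in atTop, ‖F' x‖ < ε / 2 := by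
    simpa using (Metric.tendsto_nhds.1 hF') (ε / 2) (half_pos hε)
  obtain ⟨B, hB⟩ := eventually_atTop.1 (hF.and h1)
  have h2 : Tendsto (fun T : ℝ => T⁻¹ * (‖F B‖ + ε / 2 * |B|)) atTop (𝓝 0) := by
    simpa using tendsto_inv_atTop_zero.mul_const (‖F B‖ + ε / 2 * |B|)
  filter_upwards [eventually_ge_atTop B, eventually_gt_atTop 0,
    h2.eventually_lt_const (half_pos hε)] with T hBT hT hsmall
  have hmv : ‖F T - F B‖ ≤ ε / 2 * ‖T - B‖ :=
    (convex_Ici B).norm_image_sub_le_of_norm_hasDerivWithin_le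
      (fun x hx => (hB x hx).1.hasDerivWithinAt) (fun x hx => (hB x hx).2.le)
      (Set.mem_Ici.2 le_rfl) hBT
  have hnorm : ‖F T‖ ≤ ε / 2 * T + (‖F B‖ + ε / 2 * |B|) := by
    have h3 : ‖F T‖ ≤ ‖F T - F B‖ + ‖F B‖ := by simpa using norm_add_le (F T - F B) (F B)
    rw [Real.norm_of_nonneg (sub_nonneg.2 hBT)] at hmv
    nlinarith [neg_abs_le B]
  rw [dist_zero_right, norm_smul, norm_inv, Real.norm_of_nonneg hT.le]
  calc T⁻¹ * ‖F T‖ ≤ T⁻¹ * (ε / 2 * T + (‖F B‖ + ε / 2 * |B|)) := by gcongr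
    _ = ε / 2 + T⁻¹ * (‖F B‖ + ε / 2 * |B|) := by field_simp
    _ < ε := by linarith

/-- The mean over the half-line of the exponential of a nonconstant imaginary polynomial phase
vanishes. -/
lemma tendsto_mean_exp_polynomial (p : ℝ[X]) (hp : derivative p ≠ 0) {c : ℂ} (hc : c ≠ 0)
    (hre : c.re = 0) :
    Tendsto (fun T : ℝ => T⁻¹ • ∫ x in (0 : ℝ)..T, Complex.exp (c * (p.eval x : ℝ)))
      atTop (𝓝 0) := by
  set q := derivative p with hq
  set e : ℝ → ℂ := fun x => Complex.exp (c * (p.eval x : ℝ)) with he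
  have hnorm (x : ℝ) : ‖e x‖ = 1 := by simp [he, Complex.norm_exp, hre]
  have hcont : Continuous e := by fun_prop
  have hde (x : ℝ) : HasDerivAt e (e x * (c * (q.eval x : ℝ))) x :=
    (((p.hasDerivAt x).ofReal_comp).const_mul c).cexp
  have hqev : ∀ᶠ x in atTop, q.eval x ≠ 0 := q.eventually_atTop_not_isRoot hp
  set h : ℝ → ℂ := fun x => e x / (c * (q.eval x : ℝ)) with hh
  have hder : ∀ᶠ x in atTop, HasDerivAt (fun T => (∫ x in (0 : ℝ)..T, e x) - h T)
      (e x * ((derivative q).eval x / (q ^ 2).eval x : ℝ) / c) x := by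
    filter_upwards [hqev] with x hx
    have hx' : ((q.eval x : ℝ) : ℂ) ≠ 0 := by exact_mod_cast hx
    have h1 := (hcont.integral_hasStrictDerivAt 0 x).hasDerivAt
    have h2 := (hde x).div (((q.hasDerivAt x).ofReal_comp).const_mul c) (mul_ne_zero hc hx')
    refine (h1.sub h2).congr_deriv ?_
    push_cast [eval_pow]
    field_simp
    ring
  have hlim : Tendsto (fun x : ℝ => e x * ((derivative q).eval x / (q ^ 2).eval x : ℝ) / c)
      atTop (𝓝 0) := by
    have hdeg : (derivative q).degree < (q ^ 2).degree := by
      refine (degree_derivative_lt hp).trans_le ?_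
      rw [pow_two]
      exact degree_le_mul_left q hp
    rw [tendsto_zero_iff_norm_tendsto_zero]
    have := (div_tendsto_atTop_zero_of_degree_lt _ _ hdeg).norm.div_const ‖c‖
    simpa only [norm_div, norm_mul, hnorm, one_mul, Complex.norm_real, norm_zero, zero_div]
      using this
  have hbdry : Tendsto (fun T : ℝ => T⁻¹ • h T) atTop (𝓝 0) := by
    have hdeg : (1 : ℝ[X]).degree < (X * q).degree := by
      rw [degree_mul, degree_X, degree_one]
      have : (0 : WithBot ℕ) ≤ q.degree := zero_le_degree_iff.2 hp
      exact zero_lt_one.trans_le (le_add_of_nonneg_right this)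
    rw [tendsto_zero_iff_norm_tendsto_zero]
    have := (div_tendsto_atTop_zero_of_degree_lt _ _ hdeg).norm.div_const ‖c‖
    rw [norm_zero, zero_div] at this
    refine this.congr fun T => ?_
    simp only [hh, norm_smul, norm_mul, hnorm, Complex.norm_real, norm_inv, eval_mul,
      eval_X, eval_one, norm_one, mul_inv, div_eq_mul_inv]
    ring
  have := (tendsto_inv_smul_of_deriv_tendsto_zero hder hlim).add hbdry
  simpa only [← smul_add, sub_add_cancel, add_zero] using this

lemma integral_fourier_eq_zero {T : ℝ} [hT : Fact (0 < T)] {n : ℤ} (hn : n ≠ 0) :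
    ∫ θ : AddCircle T, fourier n θ = 0 :=
  integral_eq_zero_of_add_right_eq_neg (fourier_add_half_inv_index hn hT.out)

/-- **Weyl's criterion** for continuous means: if the means along a continuous curve of every
nontrivial character vanish, then the curve is equidistributed. -/
lemma tendsto_mean_of_fourier {u : ℝ → AddCircle (1 : ℝ)} (hu : Continuous u)
    (h : ∀ n : ℤ, n ≠ 0 →
      Tendsto (fun T : ℝ => T⁻¹ • ∫ x in (0 : ℝ)..T, fourier n (u x)) atTop (𝓝 0))
    (f : C(AddCircle (1 : ℝ), ℂ)) :
    Tendsto (fun T : ℝ => T⁻¹ • ∫ x in (0 : ℝ)..T, f (u x)) atTop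
      (𝓝 (∫ θ : AddCircle (1 : ℝ), f θ)) := by
  have : IsProbabilityMeasure (volume : Measure (AddCircle (1 : ℝ))) :=
    ⟨by simp [AddCircle.measure_univ]⟩
  have hint (f : C(AddCircle (1 : ℝ), ℂ)) (T : ℝ) :
      IntervalIntegrable (fun x => f (u x)) volume 0 T :=
    (f.continuous.comp hu).intervalIntegrable _ _
  have hint' (f : C(AddCircle (1 : ℝ), ℂ)) : Integrable f :=
    f.continuous.integrable_of_hasCompactSupport (HasCompactSupport.of_compactSpace _)
  have hspan : ∀ g ∈ Submodule.span ℂ (Set.range (@fourier (1 : ℝ))),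
      Tendsto (fun T : ℝ => T⁻¹ • ∫ x in (0 : ℝ)..T, g (u x)) atTop
        (𝓝 (∫ θ : AddCircle (1 : ℝ), g θ)) := by
    intro g hg
    induction hg using Submodule.span_induction with
    | mem g hg =>
      obtain ⟨n, rfl⟩ := hg
      by_cases hn : n = 0
      · subst hn
        refine tendsto_const_nhds.congr' ?_
        filter_upwards [eventually_gt_atTop 0] with T hT
        simp [hT.ne']
      · rw [integral_fourier_eq_zero hn]
        exact h n hn
    | zero => simp
    | add f g _ _ hf hg =>
      simp only [ContinuousMap.add_apply, integral_add (hint' f) (hint' g),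
        intervalIntegral.integral_add (hint f _) (hint g _), smul_add]
      exact hf.add hg
    | smul a f _ hf =>
      simp only [ContinuousMap.smul_apply, MeasureTheory.integral_smul,
        intervalIntegral.integral_smul, smul_comm _ a]
      exact hf.const_smul a
  have hclosure : f ∈ closure (Submodule.span ℂ (Set.range (@fourier (1 : ℝ))) :
      Set C(AddCircle (1 : ℝ), ℂ)) := by
    rw [← Submodule.topologicalClosure_coe, span_fourier_closure_eq_top]
    trivial
  rw [Metric.tendsto_nhds]
  intro ε hε
  obtain ⟨g, hg, hfg⟩ := Metric.mem_closure_iff.1 hclosure (ε / 3) (by positivity)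
  rw [dist_eq_norm] at hfg
  filter_upwards [eventually_gt_atTop 0,
    (Metric.tendsto_nhds.1 (hspan g hg)) (ε / 3) (by positivity)] with T hT hgT
  have h1 : dist (T⁻¹ • ∫ x in (0 : ℝ)..T, f (u x)) (T⁻¹ • ∫ x in (0 : ℝ)..T, g (u x))
      ≤ ‖f - g‖ := by
    rw [dist_eq_norm, ← smul_sub, ← intervalIntegral.integral_sub (hint f T) (hint g T),
      norm_smul, norm_inv, Real.norm_of_nonneg hT.le]
    have := intervalIntegral.norm_integral_le_of_norm_le_const (a := 0) (b := T)
      (f := fun x => f (u x) - g (u x)) fun x _ => (f - g).norm_coe_le_norm (u x)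
    rw [sub_zero, abs_of_pos hT] at this
    calc _ ≤ T⁻¹ * (‖f - g‖ * T) := by gcongr
      _ = ‖f - g‖ := by field_simp
  have h2 : dist (∫ θ : AddCircle (1 : ℝ), g θ) (∫ θ : AddCircle (1 : ℝ), f θ) ≤ ‖f - g‖ := by
    rw [dist_comm, dist_eq_norm, ← MeasureTheory.integral_sub (hint' f) (hint' g)]
    simpa using norm_integral_le_of_norm_le_const
      (μ := (volume : Measure (AddCircle (1 : ℝ)))) (f := fun θ => f θ - g θ)
      (.of_forall fun θ => (f - g).norm_coe_le_norm θ)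
  linarith [dist_triangle4 (T⁻¹ • ∫ x in (0 : ℝ)..T, f (u x))
    (T⁻¹ • ∫ x in (0 : ℝ)..T, g (u x)) (∫ θ : AddCircle (1 : ℝ), g θ)
    (∫ θ : AddCircle (1 : ℝ), f θ)]

/-- Equidistribution of the values of a nonconstant real polynomial modulo one:
if `p` has degree `≥ 1`, then for every continuous `f : ℝ/ℤ → ℝ`,
`(1/T) ∫₀^T f(p(x) mod 1) dx → ∫_{ℝ/ℤ} f dμ` as `T → +∞`, where `μ` is the Haar
probability measure on the circle `ℝ/ℤ = AddCircle 1`. -/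
theorem polynomial_equidistributed_mod_one (p : Polynomial ℝ) (hp : 1 ≤ p.natDegree)
    (f : AddCircle (1 : ℝ) → ℝ) (hf : Continuous f) :
    Filter.Tendsto
      (fun T : ℝ => (1 / T) * ∫ x in (0 : ℝ)..T, f ((p.eval x : ℝ) : AddCircle (1 : ℝ)))
      Filter.atTop (nhds (∫ θ : AddCircle (1 : ℝ), f θ)) := by
  have hderiv : derivative p ≠ 0 := fun h0 => by
    have := derivative_eq_zero.1 h0
    omega
  have hu : Continuous fun x : ℝ => ((p.eval x : ℝ) : AddCircle (1 : ℝ)) :=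
    (AddCircle.continuous_mk' 1).comp p.continuous
  have key := tendsto_mean_of_fourier hu (fun n hn => by
    have hc : 2 * Real.pi * Complex.I * (n : ℂ) ≠ 0 := by
      simp [hn, Real.pi_ne_zero]
    simpa only [fourier_coe_apply, Complex.ofReal_one, div_one] using
      tendsto_mean_exp_polynomial p hderiv hc (by simp)) ⟨fun θ => (f θ : ℂ), by fun_prop⟩
  have hre := (Complex.continuous_re.tendsto _).comp key
  simpa [Function.comp_def, intervalIntegral.integral_ofReal, integral_complex_ofReal] using hre
end

section
/- Let (G,+) be a semimodule over a discrete semiring (R,+,·), let Λ be a compact metric space, and let f : G → Λ be an arbitrary function. Then for every ε > 0 and every finite set F ⊆ G, there exists a syndetic subset D of (R,+) such that for each d ∈ D there is an a ∈ G with diam f(a + d•F) < ε, where a + d•F = {a + d•g : g ∈ F} and diam denotes the diameter in the metric of Λ. -/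
/-- If `D` is not syndetic, then any finite index set carries a family in `R` none of whose
nonempty subsums lies in `D`. -/
theorem exists_subsums_notMem_of_not_syndetic {R ι : Type*} [AddCommMonoid R] {D : Set R}
    (hD : ¬ Syndetic D) (s : Finset ι) :
    ∃ r : ι → R, ∀ T ⊆ s, T.Nonempty → ∑ i ∈ T, r i ∉ D := by
  classical
  induction s using Finset.induction_on with
  | empty => exact ⟨0, fun T hT hne => absurd (Finset.subset_empty.1 hT) hne.ne_empty⟩
  | insert j s hj ih =>
    obtain ⟨r, hr⟩ := ih
    simp only [Syndetic, not_exists, not_forall, not_and] at hD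
    obtain ⟨t, ht⟩ := hD (s.powerset.image fun T => ∑ i ∈ T, r i)
    have update_eq {T : Finset ι} (hT : j ∉ T) :
        ∑ i ∈ T, Function.update r j t i = ∑ i ∈ T, r i :=
      Finset.sum_congr rfl fun i hi => Function.update_of_ne (ne_of_mem_of_not_mem hi hT) t r
    refine ⟨Function.update r j t, fun T hT hne => ?_⟩
    by_cases hjT : j ∈ T
    · rw [← Finset.sum_erase_add T _ hjT, update_eq (Finset.notMem_erase j T),
        Function.update_self]
      exact ht _ (Finset.mem_image_of_mem _
        (Finset.mem_powerset.2 (Finset.subset_insert_iff.1 hT)))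
    · rw [update_eq hjT]
      exact hr T ((Finset.subset_insert_iff_of_notMem hjT).1 hT) hne

/-- For a finite colouring of a semimodule, every sufficiently long family of scalars has a
nonempty subsum `d` for which some `a + d • F` is monochromatic. -/
theorem exists_subsum_mono_homothetic_copy {R G κ : Type*} [Semiring R] [AddCommMonoid G]
    [Module R G] [Finite κ] (C : G → κ) (F : Finset G) :
    ∃ (ι : Type) (_ : Fintype ι), ∀ r : ι → R, ∃ T : Finset ι, T.Nonempty ∧
      ∃ (a : G) (c : κ), ∀ g ∈ F, C (a + (∑ i ∈ T, r i) • g) = c := by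
  classical
  obtain ⟨ι, hι, hmono⟩ := Combinatorics.Line.exists_mono_in_high_dimension F κ
  refine ⟨ι, hι, fun r => ?_⟩
  obtain ⟨l, c, hl⟩ := hmono fun v => C (∑ i, r i • (v i : G))
  refine ⟨({i | l.idxFun i = none} : Finset ι), ?_,
    ∑ i with l.idxFun i ≠ none, r i • ((l.idxFun i).map Subtype.val).getD 0, c, fun g hg => ?_⟩
  · obtain ⟨i, hi⟩ := l.proper
    exact ⟨i, by simpa using hi⟩
  · rw [← hl ⟨g, hg⟩, add_comm, Finset.sum_smul]
    beta_reduce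
    rw [← Finset.sum_filter_add_sum_filter_not Finset.univ (fun i => l.idxFun i = none)
        fun i => r i • ((l ⟨g, hg⟩ i : F) : G)]
    congr 2
    · refine Finset.sum_congr rfl fun i hi => ?_
      rw [l.apply_none _ _ (Finset.mem_filter.1 hi).2]
    · refine Finset.sum_congr rfl fun i hi => ?_
      obtain ⟨y, hy⟩ := Option.ne_none_iff_exists'.1 (Finset.mem_filter.1 hi).2
      simp [hy]

/-- A compact metric space has a finite colouring in which points of equal colour are
`ε`-close. -/
theorem exists_finite_coloring_dist_lt {Λ : Type*} [PseudoMetricSpace Λ] [CompactSpace Λ]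
    {ε : ℝ} (hε : 0 < ε) :
    ∃ (s : Set Λ) (_ : s.Finite) (p : Λ → s), ∀ x y, p x = p y → dist x y < ε := by
  obtain ⟨s, -, hs, hcover⟩ :=
    Metric.finite_approx_of_totallyBounded (isCompact_univ (X := Λ)).totallyBounded
      (ε / 2) (half_pos hε)
  have hnear (x : Λ) : ∃ y : s, dist x y < ε / 2 := by
    simpa using hcover (Set.mem_univ x)
  choose p hp using hnear
  refine ⟨s, hs, p, fun x y hxy => ?_⟩
  have hy := hp y
  rw [← hxy] at hy
  linarith [hp x, dist_triangle_right x y (p x : Λ)]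

/-- For any function `f` from a semimodule `(G,+)` over a discrete semiring `(R,+,·)` to
a compact metric space `Λ`, any `ε > 0` and any finite `F ⊆ G`, there is a syndetic
subset `D` of `(R,+)` such that for each `d ∈ D` there is `a ∈ G` with
`diam f(a + d • F) < ε`. -/
theorem almost_constant_on_homothetic_copy {R G Λ : Type*} [Semiring R] [AddCommMonoid G]
    [Module R G] [MetricSpace Λ] [CompactSpace Λ]
    (f : G → Λ) (ε : ℝ) (hε : 0 < ε) (F : Finset G) :
    ∃ D : Set R, Syndetic D ∧
      ∀ d ∈ D, ∃ a : G,
        Metric.diam ((fun g => f (a + d • g)) '' (F : Set G)) < ε := by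
  refine ⟨{d | ∃ a : G, Metric.diam ((fun g => f (a + d • g)) '' (F : Set G)) < ε}, ?_,
    fun d hd => hd⟩
  by_contra hD
  obtain ⟨s, hs, p, hp⟩ := exists_finite_coloring_dist_lt (Λ := Λ) (half_pos hε)
  have : Finite s := hs
  obtain ⟨ι, _, hmono⟩ := exists_subsum_mono_homothetic_copy (R := R) (p ∘ f) F
  obtain ⟨r, hr⟩ := exists_subsums_notMem_of_not_syndetic hD (Finset.univ : Finset ι)
  obtain ⟨T, hT, a, c, hc⟩ := hmono r
  refine hr T (Finset.subset_univ T) hT ⟨a, ?_⟩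
  refine (Metric.diam_le_of_forall_dist_le (half_pos hε).le ?_).trans_lt (half_lt_self hε)
  rintro _ ⟨g, hg, rfl⟩ _ ⟨h, hh, rfl⟩
  exact (hp _ _ ((hc g hg).trans (hc h hh).symm)).le
end

section
/- Let (R,+,·) be a discrete *-semiring, i.e. for any finitely many s₁,…,s_k ∈ R the union 𝔑_{s₁} ∪ ⋯ ∪ 𝔑_{s_k} is a proper subset of R, where 𝔑_s = {t ∈ R : s + t = 0}. Let (G,+) be a semimodule over R, let G₁ ⊆ G₂ ⊆ ⋯ be an increasing sequence of subsets of G with G = ⋃_{n≥1} Gₙ, let F ⊆ G be a finite set, and let q ∈ ℕ. Then there exists a number N = N(q,F) such that whenever n ≥ N and Gₙ = B₁ ∪ ⋯ ∪ B_q is a partition of Gₙ into q subsets, one of the cells B_j contains a homothetic copy of F: there exist a ∈ G and d ∈ R with d ≠ 0 such that a + d•F ⊆ B_j, where a + d•F = {a + d•g : g ∈ F}. -/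
open Finset in
/-- If no finite union of the sets `{t | r + t = 0}` is the whole of `R`, then every finite index
type carries a family in `R` with no vanishing nonempty subsums. -/
theorem exists_family_sum_ne_zero {R ι : Type*} [AddCommMonoid R] [Finite ι]
    (hstar : ∀ s : Finset R, ∃ t : R, ∀ r ∈ s, r + t ≠ 0) :
    ∃ t : ι → R, ∀ u : Finset ι, u.Nonempty → ∑ i ∈ u, t i ≠ 0 := by
  classical
  have := Fintype.ofFinite ι
  suffices h : ∀ s : Finset ι, ∃ t : ι → R, ∀ u ⊆ s, u.Nonempty → ∑ i ∈ u, t i ≠ 0 by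
    obtain ⟨t, ht⟩ := h univ
    exact ⟨t, fun u => ht u (subset_univ u)⟩
  intro s
  induction s using Finset.induction_on with
  | empty => exact ⟨0, fun u hu hne => absurd (subset_empty.mp hu) hne.ne_empty⟩
  | insert j s hj ih =>
    obtain ⟨t, ht⟩ := ih
    obtain ⟨x, hx⟩ := hstar (s.powerset.image fun u => ∑ i ∈ u, t i)
    have hsum : ∀ u : Finset ι, j ∉ u → ∑ i ∈ u, Function.update t j x i = ∑ i ∈ u, t i :=
      fun u hu => sum_congr rfl fun i hi =>
        Function.update_of_ne (ne_of_mem_of_not_mem hi hu) _ _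
    refine ⟨Function.update t j x, fun u hu hne => ?_⟩
    by_cases hju : j ∈ u
    · rw [← sum_erase_add u _ hju, hsum _ (notMem_erase j u), Function.update_self]
      exact hx _ (mem_image_of_mem _ (mem_powerset.mpr (subset_insert_iff.mp hu)))
    · rw [hsum u hju]
      exact ht u ((subset_insert_iff_of_notMem hju).mp hu) hne

open Finset in
/-- The image of a combinatorial line under a weighted sum is a homothetic copy of the alphabet. -/
theorem Combinatorics.Line.exists_sum_smul_eq {R G α ι : Type*} [Semiring R] [AddCommMonoid G]
    [Module R G] [Fintype ι] (l : Combinatorics.Line α ι) (t : ι → R) (f : α → G) :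
    ∃ (a : G) (u : Finset ι), u.Nonempty ∧
      ∀ x, ∑ i, t i • f (l x i) = a + (∑ i ∈ u, t i) • f x := by
  classical
  obtain ⟨i₀, hi₀⟩ := l.proper
  refine ⟨∑ i with l.idxFun i ≠ none, t i • (l.idxFun i).elim 0 f,
    ({i | l.idxFun i = none} : Finset ι), ⟨i₀, by simpa using hi₀⟩, fun x => ?_⟩
  rw [← sum_filter_add_sum_filter_not univ (fun i => l.idxFun i = none), add_comm, sum_smul]
  congr 1
  · refine sum_congr rfl fun i hi => ?_
    obtain ⟨y, hy⟩ := Option.ne_none_iff_exists'.mp (mem_filter.mp hi).2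
    simp [hy]
  · refine sum_congr rfl fun i hi => ?_
    rw [l.apply_none x i (mem_filter.mp hi).2]


/-- Finitary formulation of the van der Waerden theorem for semimodules over a discrete
`*`-semiring: if `(R,+,·)` satisfies the `*`-condition (for any finitely many
`s₁,…,s_k ∈ R` the union of the sets `𝔑_{sᵢ} = {t : sᵢ + t = 0}` is a proper subset of
`R`, i.e. there is `t` with `sᵢ + t ≠ 0` for all `i`), `(G,+)` is an `R`-semimodule,
`G₁ ⊆ G₂ ⊆ ⋯` is an increasing sequence of subsets with `G = ⋃ₙ Gₙ`, `F ⊆ G` is finite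
and `q ∈ ℕ`, then there is `N = N(q,F)` such that whenever `n ≥ N` and
`Gₙ = B₁ ∪ ⋯ ∪ B_q` is a partition into `q` sets, one of the cells contains a homothetic
copy `a + d • F` of `F` with `a ∈ G`, `d ∈ R`, `d ≠ 0`. -/
theorem finitary_vdW_semimodule {R G : Type*} [Semiring R] [AddCommMonoid G] [Module R G]
    (hstar : ∀ s : Finset R, ∃ t : R, ∀ r ∈ s, r + t ≠ 0)
    (Gn : ℕ → Set G) (hmono : Monotone Gn) (hunion : (⋃ n, Gn n) = Set.univ)
    (F : Finset G) (q : ℕ) :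
    ∃ N : ℕ, ∀ n ≥ N, ∀ B : Fin q → Set G, (⋃ j, B j) = Gn n →
      ∃ j : Fin q, ∃ a : G, ∃ d : R, d ≠ 0 ∧ ∀ g ∈ F, a + d • g ∈ B j := by
  obtain ⟨ι, _, hι⟩ := Combinatorics.Line.exists_mono_in_high_dimension F (Fin q)
  obtain ⟨t, ht⟩ := exists_family_sum_ne_zero (ι := ι) hstar
  let p : (ι → F) → G := fun v => ∑ i, t i • (v i : G)
  obtain ⟨N, hN⟩ := hmono.directed_le.exists_mem_subset_of_finset_subset_biUnion
    (s := Set.finite_range p |>.toFinset) (by simp [hunion])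
  refine ⟨N, fun n hn B hB => ?_⟩
  have hcover : ∀ v, ∃ j, p v ∈ B j := fun v => by
    rw [← Set.mem_iUnion, hB]
    exact hmono hn (hN (by simp))
  choose C hC using hcover
  obtain ⟨l, j, hl⟩ := hι C
  obtain ⟨a, u, hu, hsum⟩ := l.exists_sum_smul_eq t ((↑) : F → G)
  refine ⟨j, a, ∑ i ∈ u, t i, ht u hu, fun g hg => ?_⟩
  rw [← hsum ⟨g, hg⟩, ← hl ⟨g, hg⟩]
  exact hC _
end
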